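/- arXiv:math/0405375 — 3 statements merged into one kernel-verified Lean document; each statement's English description precedes it below -/
import Mathlib

section
/- For every field k and every integer n ≥ 2, the quadratic algebra Q_n is Koszul: the trivial right Q_n-module k = Q_n/(Q_n)_{≥1} admits a graded free resolution ⋯ → P_2 → P_1 → P_0 → k → 0 of right Q_n-modules in which, for every i ≥ 0, the module P_i is a graded free module all of whose free generators lie in degree i (i.e., P_i is a direct sum of copies of Q_n with grading shifted by i), and all maps are degree-preserving module homomorphisms. -/
/-!
STATEMENT 0: For every field `k` and every integer `n ≥ 2`, the quadratic algebra `Q_n` is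
Koszul: the trivial right `Q_n`-module `k = Q_n/(Q_n)_{≥1}` admits a graded free resolution
`⋯ → P_2 → P_1 → P_0 → k → 0` of right `Q_n`-modules where every `P_i` is a graded free
module all of whose free generators lie in degree `i`, and all maps preserve degrees.

Right `Q_n`-modules are formalized as left modules over the opposite algebra
`R = Q_nᵐᵒᵖ`; a graded free module with all generators in degree `i` is formalized
concretely as `β →₀ R` with degree-`m` component `{x | ∀ b, x b ∈ R_{m−i}}`
(zero for `m < i`).
-/

noncomputable section

open Finset MulOpposite

/-- Index type for generators: nonempty subsets `A ⊆ I_n = {1,…,n}` (modeled as `Fin n`). -/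
abbrev SubsetIdx (n : ℕ) := {A : Finset (Fin n) // A.Nonempty}

/-- The free associative unital `k`-algebra `F` on the generators `r_A`. -/
abbrev FreeA (k : Type) [Field k] (n : ℕ) := FreeAlgebra k (SubsetIdx n)

/-- The generator `r_A`, with the convention `r_∅ = 0`. -/
def rGen (k : Type) [Field k] (n : ℕ) (A : Finset (Fin n)) : FreeA k n :=
  if h : A.Nonempty then FreeAlgebra.ι k (⟨A, h⟩ : SubsetIdx n) else 0

/-- The quadratic relation `f_{A;i,j}` defining `Q_n`. -/
def fRel (k : Type) [Field k] (n : ℕ) (A : Finset (Fin n)) (i j : Fin n) : FreeA k n :=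
  rGen k n A * (rGen k n (A.erase i) - rGen k n (A.erase j))
    + (rGen k n (A.erase i) - rGen k n (A.erase j)) * rGen k n ((A.erase i).erase j)
    - rGen k n (A.erase i) ^ 2 + rGen k n (A.erase j) ^ 2

/-- The relation identifying each `f_{A;i,j}` (for `i, j ∈ A`) with `0`. -/
inductive QnRel (k : Type) [Field k] (n : ℕ) : FreeA k n → FreeA k n → Prop
  | rel (A : Finset (Fin n)) (i j : Fin n) (hi : i ∈ A) (hj : j ∈ A) :
      QnRel k n (fRel k n A i j) 0

/-- The algebra `Q_n`. -/
abbrev Qn (k : Type) [Field k] (n : ℕ) := RingQuot (QnRel k n)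

/-- The quotient map `F → Q_n`. -/
def QnMk (k : Type) [Field k] (n : ℕ) : FreeA k n →ₐ[k] Qn k n :=
  RingQuot.mkAlgHom k (QnRel k n)

/-- The degree-`d` component of `F`: the `k`-span of the words of length `d`. -/
def FreeADeg (k : Type) [Field k] (n : ℕ) (d : ℕ) : Submodule k (FreeA k n) :=
  Submodule.span k
    {x | ∃ l : List (SubsetIdx n), l.length = d ∧ x = (l.map (FreeAlgebra.ι k)).prod}

/-- The degree-`d` graded component of `Q_n` (image of that of `F`; the relations are
homogeneous of degree `2`, so `Q_n` inherits the grading of `F`). -/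
def QnDeg (k : Type) [Field k] (n : ℕ) (d : ℕ) : Submodule k (Qn k n) :=
  (FreeADeg k n d).map (QnMk k n).toLinearMap

/-- The opposite algebra `R = Q_nᵐᵒᵖ`; left `R`-modules are right `Q_n`-modules. -/
abbrev QnOp (k : Type) [Field k] (n : ℕ) := (Qn k n)ᵐᵒᵖ

/-- The degree-`d` graded component of `R = Q_nᵐᵒᵖ`. -/
def QnOpDeg (k : Type) [Field k] (n : ℕ) (d : ℕ) : Submodule k (QnOp k n) :=
  (QnDeg k n d).map (opLinearEquiv k).toLinearMap

/-- The augmentation ideal `(Q_n)_{≥1}`, spanned by the elements of positive degree,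
as a left ideal of `R = Q_nᵐᵒᵖ` (i.e. as a right ideal of `Q_n`). -/
def augIdealQ (k : Type) [Field k] (n : ℕ) : Ideal (QnOp k n) :=
  Ideal.span {x : QnOp k n | ∃ d : ℕ, 1 ≤ d ∧ x ∈ QnOpDeg k n d}

/-- The trivial right `Q_n`-module `k = Q_n/(Q_n)_{≥1}`. -/
abbrev TrivQ (k : Type) [Field k] (n : ℕ) := QnOp k n ⧸ augIdealQ k n

/-- The degree-`m` component of the free right `Q_n`-module shifted by `i` (all free
generators in degree `i`): it is `R_{m−i}` for `m ≥ i` and `0` for `m < i`. -/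
def shiftDegQ (k : Type) [Field k] (n : ℕ) (i m : ℕ) : Submodule k (QnOp k n) :=
  if i ≤ m then QnOpDeg k n (m - i) else ⊥

/-! ### Elementary and complete functions attached to a family indexed by finite sets -/

section Eta

variable {ι : Type*} [DecidableEq ι] {R : Type*} [Ring R] {M : Type*} [AddCommGroup M] [Module R M]

/-- Lifts to a module of the complete symmetric functions of pseudo-roots: starting from a family
`m`, each `etaFn r m (k + 1)` is the potential of the weights
`(r D - r (D \ i)) • etaFn r m k D`. -/
def etaFn (r : Finset ι → R) (m : Finset ι → M) : ℕ → Finset ι → M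
  | 0, D => m D
  | k + 1, D =>
    if h : D.Nonempty then
      etaFn r m (k + 1) (D.erase h.choose) + (r D - r (D.erase h.choose)) • etaFn r m k D
    else 0
termination_by k D => (k, D.card)
decreasing_by
  · exact Prod.Lex.right _ (Finset.card_erase_lt_of_mem h.choose_spec)
  · exact Prod.Lex.left _ _ (Nat.lt_succ_self k)

/-- The pseudo-root relations in a module, for all index sets with at most `p` elements. -/
def PseudoRel (r : Finset ι → R) (m : Finset ι → M) (p : ℕ) : Prop :=
  ∀ C : Finset ι, C.card ≤ p → ∀ i ∈ C, ∀ j ∈ C,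
    (r (C.erase i) - r ((C.erase i).erase j)) • (m C - m (C.erase i)) =
      (r (C.erase j) - r ((C.erase i).erase j)) • (m C - m (C.erase j))

theorem etaFn_zero (r : Finset ι → R) (m : Finset ι → M) (D : Finset ι) :
    etaFn r m 0 D = m D := by
  rw [etaFn]

theorem etaFn_empty (r : Finset ι → R) (m : Finset ι → M) (k : ℕ) :
    etaFn r m (k + 1) ∅ = 0 := by
  rw [etaFn]; simp

theorem etaFn_choose (r : Finset ι → R) (m : Finset ι → M) (k : ℕ) {D : Finset ι}
    (h : D.Nonempty) :
    etaFn r m (k + 1) D =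
      etaFn r m (k + 1) (D.erase h.choose) + (r D - r (D.erase h.choose)) • etaFn r m k D := by
  conv_lhs => rw [etaFn]
  simp [h]

theorem etaFn_map {M' : Type*} [AddCommGroup M'] [Module R M'] (f : M →ₗ[R] M')
    (r : Finset ι → R) (m : Finset ι → M) (k : ℕ) (D : Finset ι) :
    etaFn r (fun C => f (m C)) k D = f (etaFn r m k D) := by
  induction k generalizing D with
  | zero => simp only [etaFn_zero]
  | succ k ihk =>
    induction D using Finset.strongInduction with
    | H D ih =>
      rcases D.eq_empty_or_nonempty with rfl | h
      · simp only [etaFn_empty, map_zero]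
      · rw [etaFn_choose _ _ _ h, etaFn_choose _ _ _ h, map_add, map_smul, ihk,
          ih _ (Finset.erase_ssubset h.choose_spec)]

/-- The recursion defining `etaFn` holds for every element that may be removed. -/
theorem etaFn_succ {r : Finset ι → R} {m : Finset ι → M} {p : ℕ} (hr : PseudoRel r r p)
    (hm : PseudoRel r m p) (k : ℕ) (D : Finset ι) (hD : D.card ≤ p) (i : ι) (hi : i ∈ D) :
    etaFn r m (k + 1) D =
      etaFn r m (k + 1) (D.erase i) + (r D - r (D.erase i)) • etaFn r m k D := by
  induction k generalizing D i with
  | zero =>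
    induction D using Finset.strongInduction generalizing i with
    | H D ih =>
      have h : D.Nonempty := ⟨i, hi⟩
      set j := h.choose with hj
      have hjD : j ∈ D := h.choose_spec
      have e := etaFn_choose r m 0 h
      rw [← hj] at e
      by_cases hij : i = j
      · rw [hij]; exact e
      have e1 := ih (D.erase i) (Finset.erase_ssubset hi)
        ((Finset.card_le_card (Finset.erase_subset _ _)).trans hD) j
        (Finset.mem_erase.2 ⟨Ne.symm hij, hjD⟩)
      have e2 := ih (D.erase j) (Finset.erase_ssubset hjD)
        ((Finset.card_le_card (Finset.erase_subset _ _)).trans hD) i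
        (Finset.mem_erase.2 ⟨hij, hi⟩)
      rw [Finset.erase_right_comm] at e2
      have key := hm D hD i hi j hjD
      rw [e, e1, e2]
      simp only [etaFn_zero, sub_smul, smul_sub] at key ⊢
      rw [← sub_eq_zero] at key ⊢
      rw [← key]
      abel
  | succ k ihk =>
    induction D using Finset.strongInduction generalizing i with
    | H D ih =>
      have h : D.Nonempty := ⟨i, hi⟩
      set j := h.choose with hj
      have hjD : j ∈ D := h.choose_spec
      have e := etaFn_choose r m (k + 1) h
      rw [← hj] at e
      by_cases hij : i = j
      · rw [hij]; exact e
      have e1 := ih (D.erase i) (Finset.erase_ssubset hi)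
        ((Finset.card_le_card (Finset.erase_subset _ _)).trans hD) j
        (Finset.mem_erase.2 ⟨Ne.symm hij, hjD⟩)
      have e2 := ih (D.erase j) (Finset.erase_ssubset hjD)
        ((Finset.card_le_card (Finset.erase_subset _ _)).trans hD) i
        (Finset.mem_erase.2 ⟨hij, hi⟩)
      rw [Finset.erase_right_comm] at e2
      have key := congrArg (fun x => x • etaFn r m k D) (hr D hD i hi j hjD)
      have f1 := ihk D hD i hi
      have f2 := ihk D hD j hjD
      rw [e, e1, e2, eq_sub_of_add_eq f1.symm, eq_sub_of_add_eq f2.symm]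
      simp only [smul_eq_mul, mul_smul, sub_smul, smul_sub] at key ⊢
      rw [← sub_eq_zero] at key ⊢
      rw [← key]
      abel

end Eta

/-! ### Ideals of differences and the presentation of a pseudo-root algebra -/

section PseudoRoot

set_option linter.unusedSectionVars false

variable {ι : Type*} [DecidableEq ι] [Fintype ι] {R : Type*} [Ring R]

/-- The left ideal generated by the differences `r C - r D` with `C, D ∈ Y`. -/
def diffIdeal (r : Finset ι → R) (Y : Set (Finset ι)) : Ideal R where
  carrier := {x | ∃ a : Finset ι → R, (∀ C, C ∉ Y → a C = 0) ∧ ∑ C, a C = 0 ∧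
    ∑ C, a C * r C = x}
  zero_mem' := ⟨0, by simp⟩
  add_mem' := by
    rintro _ _ ⟨a, ha, ha0, rfl⟩ ⟨b, hb, hb0, rfl⟩
    refine ⟨a + b, fun C hC => by simp [ha C hC, hb C hC], ?_, ?_⟩
    · simp [Finset.sum_add_distrib, ha0, hb0]
    · simp [Finset.sum_add_distrib, add_mul]
  smul_mem' := by
    rintro c _ ⟨a, ha, ha0, rfl⟩
    refine ⟨fun C => c * a C, fun C hC => by simp [ha C hC], ?_, ?_⟩
    · rw [← Finset.mul_sum, ha0, mul_zero]
    · simp [Finset.mul_sum, mul_assoc]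

theorem diffIdeal_mono {r : Finset ι → R} {Y Z : Set (Finset ι)} (h : Y ⊆ Z) :
    diffIdeal r Y ≤ diffIdeal r Z := by
  rintro _ ⟨a, ha, ha0, rfl⟩
  exact ⟨a, fun C hC => ha C fun h' => hC (h h'), ha0, rfl⟩

theorem sub_mem_diffIdeal {r : Finset ι → R} {Y : Set (Finset ι)} {C D : Finset ι}
    (hC : C ∈ Y) (hD : D ∈ Y) : r C - r D ∈ diffIdeal r Y := by
  refine ⟨Pi.single C 1 - Pi.single D 1, fun E hE => ?_, ?_, ?_⟩
  · rw [Pi.sub_apply, Pi.single_eq_of_ne, Pi.single_eq_of_ne, sub_zero]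
    · rintro rfl; exact hE hD
    · rintro rfl; exact hE hC
  · simp
  · simp [sub_mul, Finset.sum_sub_distrib, Pi.single_apply, ite_mul]

/-- A family with vanishing total, concentrated on `Y`, is a combination of differences with any
fixed base point of `Y`. -/
theorem diffIdeal_le {r : Finset ι → R} {Y : Set (Finset ι)} {I : Ideal R} {D : Finset ι}
    (h : ∀ C ∈ Y, r C - r D ∈ I) : diffIdeal r Y ≤ I := by
  rintro _ ⟨a, ha, ha0, rfl⟩
  have : ∑ C, a C * r C = ∑ C, a C * (r C - r D) := by
    simp only [mul_sub, Finset.sum_sub_distrib]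
    rw [← Finset.sum_mul, ha0, zero_mul, sub_zero]
  rw [this]
  refine Submodule.sum_mem _ fun C _ => ?_
  by_cases hC : C ∈ Y
  · exact I.mul_mem_left _ (h C hC)
  · simp [ha C hC]

/-- The left ideal of differences of the facets of the simplex `A`. -/
abbrev facetIdeal (r : Finset ι → R) (A : Finset ι) : Ideal R :=
  diffIdeal r {C | C ⊆ A ∧ C.card + 1 = A.card}

theorem exists_erase_of_facet {A C : Finset ι} (h : C ⊆ A) (hc : C.card + 1 = A.card) :
    ∃ i ∈ A, C = A.erase i := by
  obtain ⟨i, hi⟩ := Finset.card_eq_one.1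
    (show (A \ C).card = 1 by rw [Finset.card_sdiff_of_subset h]; omega)
  have hiA : i ∈ A \ C := hi ▸ Finset.mem_singleton_self i
  refine ⟨i, (Finset.mem_sdiff.1 hiA).1, ?_⟩
  rw [Finset.erase_eq, ← hi, Finset.sdiff_sdiff_eq_self h]

/-- The vector of coefficients of the pseudo-root relation attached to `C`, `i` and `j`. -/
def relVec (r : Finset ι → R) (C : Finset ι) (i j : ι) : Finset ι → R :=
  (r (C.erase i) - r ((C.erase i).erase j)) • (Pi.single C 1 - Pi.single (C.erase i) 1) -
    (r (C.erase j) - r ((C.erase i).erase j)) • (Pi.single C 1 - Pi.single (C.erase j) 1)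

/-- The module of relations coming from sets with at most `q` elements. -/
def relSpan (r : Finset ι → R) (q : ℕ) : Submodule R (Finset ι → R) :=
  Submodule.span R {v | ∃ C i j, C.card ≤ q ∧ i ∈ C ∧ j ∈ C ∧ v = relVec r C i j}

/-- A ring with elements `r A` satisfying the pseudo-root relations, which present the left ideal
generated by the `r A`, and with projections `π d` onto the components of a grading in which the
`r A` have degree one. -/
structure IsPseudoRootRing (r : Finset ι → R) (π : ℕ → R →+ R) : Prop where
  rel : ∀ p, PseudoRel r r p
  pres : ∀ b : Finset ι → R, b ∅ = 0 → ∑ A, b A * r A = 0 → b ∈ relSpan r (Fintype.card ι)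
  empty : r ∅ = 0
  proj_zero : ∀ x A, π 0 (x * r A) = 0
  proj_succ : ∀ d x A, π (d + 1) (x * r A) = π d x * r A
  proj_proj : ∀ d x, π d (π d x) = π d x
  sum_proj : ∀ x, ∃ N, ∀ M ≥ N, ∑ d ∈ Finset.range M, π d x = x

variable {r : Finset ι → R} {π : ℕ → R →+ R}

theorem IsPseudoRootRing.mem_of_proj (h : IsPseudoRootRing r π) {I : Ideal R} {x : R}
    (hx : ∀ d, π d x ∈ I) : x ∈ I := by
  obtain ⟨N, hN⟩ := h.sum_proj x
  rw [← hN N le_rfl]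
  exact Submodule.sum_mem _ fun d _ => hx d

theorem IsPseudoRootRing.proj_zero_sum (h : IsPseudoRootRing r π) (a : Finset ι → R) :
    π 0 (∑ C, a C * r C) = 0 := by
  simp [map_sum, h.proj_zero]

theorem IsPseudoRootRing.proj_succ_sum (h : IsPseudoRootRing r π) (d : ℕ) (a : Finset ι → R) :
    π (d + 1) (∑ C, a C * r C) = ∑ C, π d (a C) * r C := by
  simp [map_sum, h.proj_succ]

theorem IsPseudoRootRing.proj_mem (h : IsPseudoRootRing r π) {Y : Set (Finset ι)} {x : R}
    (hx : x ∈ diffIdeal r Y) (d : ℕ) : π d x ∈ diffIdeal r Y := by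
  obtain ⟨a, ha, ha0, rfl⟩ := hx
  cases d with
  | zero => rw [h.proj_zero_sum]; exact zero_mem _
  | succ d =>
    rw [h.proj_succ_sum]
    exact ⟨fun C => π d (a C), fun C hC => by simp [ha C hC], by rw [← map_sum, ha0, map_zero], rfl⟩

/-- In degree `e`, the top coefficients of a relation between the `r C` lie in the facet ideal. -/
def TopCoeff (r : Finset ι → R) (π : ℕ → R →+ R) (e : ℕ) : Prop :=
  ∀ (b : Finset ι → R) (A : Finset ι), A.Nonempty → (∀ C, A.card < C.card → b C = 0) →
    ∑ C, b C * r C = 0 → π e (b A) ∈ facetIdeal r A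

theorem exists_facet_coeff {d e q : ℕ} (he : e ≤ d)
    (H : ∀ e ≤ d, TopCoeff r π e) {a : Finset ι → R} (ha : ∀ C, C.card ≠ q → a C = 0)
    (ha0 : ∑ C, a C = 0) (har : ∑ C, a C * r C = 0) (D : Finset ι) :
    ∃ g : Finset ι → R, (∀ E, ¬ ((E ⊆ D ∧ E.card + 1 = D.card) ∧ D.card = q) → g E = 0) ∧
      ∑ E, g E = 0 ∧ ∑ E, g E * r E = π e (a D) := by
  by_cases hD : D.card = q
  · rcases D.eq_empty_or_nonempty with rfl | hne
    · refine ⟨0, by simp, by simp, ?_⟩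
      have : a ∅ = 0 := by
        rw [← ha0, Finset.sum_eq_single ∅] <;> simp
        intro b hb
        apply ha
        rw [← hD]; simpa using hb
      simp [this]
    · obtain ⟨g, hg, hg'⟩ := H e he a D hne (fun C hC => ha C (by omega)) har
      exact ⟨g, fun E hE => hg E fun hE' => hE ⟨hE', hD⟩, hg'⟩
  · exact ⟨0, by simp, by simp, by simp [ha D hD]⟩

section Syzygy

variable {M : Type*} [AddCommGroup M] [Module R M]

theorem facet_smul_etaFn {m : Finset ι → M} {p : ℕ} (hr : PseudoRel r r p) (hm : PseudoRel r m p)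
    (k : ℕ) {D : Finset ι} (hD : D.card ≤ p) {c : Finset ι → R}
    (hc : ∀ E, ¬ (E ⊆ D ∧ E.card + 1 = D.card) → c E = 0) (hc0 : ∑ E, c E = 0) :
    (∑ E, c E * r E) • etaFn r m k D = ∑ E, c E • etaFn r m (k + 1) E := by
  have key : ∀ E, c E • etaFn r m (k + 1) E =
      c E • (etaFn r m (k + 1) D - r D • etaFn r m k D) + (c E * r E) • etaFn r m k D := by
    intro E
    by_cases hE : E ⊆ D ∧ E.card + 1 = D.card
    · obtain ⟨i, hi, rfl⟩ := exists_erase_of_facet hE.1 hE.2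
      rw [etaFn_succ hr hm k D hD i hi, mul_smul, ← smul_add]
      congr 1
      rw [sub_smul]; abel
    · simp [hc E hE]
  rw [Finset.sum_congr rfl fun E _ => key E, Finset.sum_add_distrib, ← Finset.sum_smul, hc0,
    zero_smul, zero_add, Finset.sum_smul]

/-- A linear syzygy between the `r D` with `D` of fixed size is also one between the higher
complete functions. -/
theorem IsPseudoRootRing.syzygy (h : IsPseudoRootRing r π) {m : Finset ι → M} {p : ℕ}
    (hm : PseudoRel r m p) (d : ℕ) (H : ∀ e ≤ d, TopCoeff r π e) (k q : ℕ) (hq : q ≤ p)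
    (a : Finset ι → R) (ha : ∀ C, C.card ≠ q → a C = 0) (ha0 : ∑ C, a C = 0)
    (har : ∑ C, a C * r C = 0) : ∑ C, π d (a C) • etaFn r m (k + 1) C = 0 := by
  induction d generalizing k q a with
  | zero =>
    refine Finset.sum_eq_zero fun D _ => ?_
    obtain ⟨g, -, -, hgr⟩ := exists_facet_coeff le_rfl H ha ha0 har D
    rw [← h.proj_proj, ← hgr, h.proj_zero_sum, zero_smul]
  | succ e ih =>
    choose g hg hg0 hgr using exists_facet_coeff le_rfl H ha ha0 har
    have step : ∀ D, π (e + 1) (a D) • etaFn r m (k + 1) D =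
        ∑ E, π e (g D E) • etaFn r m (k + 2) E := by
      intro D
      rw [← h.proj_proj, ← hgr, h.proj_succ_sum]
      by_cases hD : D.card = q
      · refine facet_smul_etaFn (h.rel p) hm (k + 1) (hD.trans_le hq) (fun E hE => ?_) ?_
        · rw [hg D E fun hE' => hE hE'.1, map_zero]
        · rw [← map_sum, hg0, map_zero]
      · have : ∀ E, g D E = 0 := fun E => hg D E fun hE' => hD hE'.2
        simp [this]
    have := ih (fun e' he' => H e' (by omega)) (k + 1) (q - 1) (by omega)
      (fun E => ∑ D, g D E)
      (fun E hE => Finset.sum_eq_zero fun D _ => hg D E fun hE' => hE (by omega))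
      (by rw [Finset.sum_comm]; exact Finset.sum_eq_zero fun D _ => hg0 D)
      (by
        simp only [Finset.sum_mul]
        rw [Finset.sum_comm, Finset.sum_congr rfl fun D _ => hgr D, ← map_sum, ha0, map_zero])
    rw [Finset.sum_congr rfl fun D _ => step D, Finset.sum_comm, ← this]
    refine Finset.sum_congr rfl fun E _ => ?_
    rw [map_sum, Finset.sum_smul]

end Syzygy

/-- The elements that raise degrees by one under multiplication on the right. -/
def degOne (π : ℕ → R →+ R) : AddSubgroup R where
  carrier := {y | (∀ x, π 0 (x * y) = 0) ∧ ∀ d x, π (d + 1) (x * y) = π d x * y}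
  zero_mem' := by simp
  add_mem' := by
    rintro y z ⟨hy, hy'⟩ ⟨hz, hz'⟩
    exact ⟨fun x => by simp [mul_add, hy, hz], fun d x => by simp [mul_add, hy', hz']⟩
  neg_mem' := by
    rintro y ⟨hy, hy'⟩
    exact ⟨fun x => by simp [hy], fun d x => by simp [hy']⟩

theorem IsPseudoRootRing.mem_degOne (h : IsPseudoRootRing r π) (A : Finset ι) :
    r A ∈ degOne π :=
  ⟨fun x => h.proj_zero x A, fun d x => h.proj_succ d x A⟩

theorem smul_single_mem_degOne {y : R} (hy : y ∈ degOne π) (C D : Finset ι) :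
    (y • (Pi.single C 1 : Finset ι → R)) D ∈ degOne π := by
  rw [Pi.smul_apply, Pi.single_apply]
  split_ifs
  · simpa using hy
  · simp

theorem compLeft_zero_smul {v : Finset ι → R} (hv : ∀ C, v C ∈ degOne π) (x : R) :
    (π 0).compLeft (Finset ι) (x • v) = 0 := by
  ext C; exact (hv C).1 x

theorem compLeft_succ_smul {v : Finset ι → R} (hv : ∀ C, v C ∈ degOne π) (d : ℕ) (x : R) :
    (π (d + 1)).compLeft (Finset ι) (x • v) = π d x • v := by
  ext C; exact (hv C).2 d x

theorem IsPseudoRootRing.relVec_mem_degOne (h : IsPseudoRootRing r π) (C : Finset ι) (i j : ι)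
    (D : Finset ι) : relVec r C i j D ∈ degOne π := by
  simp only [relVec, smul_sub, sub_smul, Pi.sub_apply]
  have := fun A B => smul_single_mem_degOne (h.mem_degOne A) B D
  refine sub_mem (sub_mem ?_ ?_) (sub_mem ?_ ?_) <;> exact sub_mem (this _ _) (this _ _)

theorem IsPseudoRootRing.compLeft_mem_relSpan (h : IsPseudoRootRing r π) {q : ℕ}
    {v : Finset ι → R} (hv : v ∈ relSpan r q) (d : ℕ) :
    (π d).compLeft (Finset ι) v ∈ relSpan r q := by
  induction hv using Submodule.closure_induction with
  | zero => simp
  | add x y _ _ hx hy => rw [map_add]; exact add_mem hx hy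
  | smul_mem c x hx =>
    obtain ⟨C, i, j, hC, hi, hj, rfl⟩ := hx
    cases d with
    | zero => rw [compLeft_zero_smul (h.relVec_mem_degOne C i j)]; exact zero_mem _
    | succ d =>
      rw [compLeft_succ_smul (h.relVec_mem_degOne C i j)]
      exact Submodule.smul_mem _ _ (Submodule.subset_span ⟨C, i, j, hC, hi, hj, rfl⟩)

theorem relVec_apply_of_card_lt {C D : Finset ι} (i j : ι) (h : C.card < D.card) :
    relVec r C i j D = 0 := by
  have h1 : D ≠ C := by rintro rfl; omega
  have h2 : ∀ i, D ≠ C.erase i := by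
    rintro i rfl
    have := Finset.card_le_card (Finset.erase_subset i C)
    omega
  simp [relVec, Pi.single_eq_of_ne h1, Pi.single_eq_of_ne (h2 _)]

theorem relSpan_apply_of_card_lt {q : ℕ} {v : Finset ι → R} (hv : v ∈ relSpan r q) {D : Finset ι}
    (hD : q < D.card) : v D = 0 := by
  have : relSpan r q ≤ LinearMap.ker (LinearMap.proj (R := R) (φ := fun _ : Finset ι => R) D) := by
    refine Submodule.span_le.2 ?_
    rintro _ ⟨C, i, j, hC, -, -, rfl⟩
    exact relVec_apply_of_card_lt i j (by omega)
  exact this hv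

/-- The functions `etaFn` of the standard basis. -/
abbrev etaVec (r : Finset ι → R) : Finset ι → Finset ι → R :=
  etaFn r (fun C => (Pi.single C 1 : Finset ι → R)) 1

theorem etaVec_apply_of_card_lt {D C : Finset ι} (h : D.card < C.card) : etaVec r D C = 0 := by
  induction D using Finset.strongInduction with
  | H D ih =>
    rcases D.eq_empty_or_nonempty with rfl | hne
    · rw [etaVec, etaFn_empty]; rfl
    · have hlt := Finset.card_erase_lt_of_mem hne.choose_spec
      have hCD : C ≠ D := by rintro rfl; omega
      have ih' : etaFn r (fun C => (Pi.single C 1 : Finset ι → R)) (0 + 1)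
          (D.erase hne.choose) C = 0 := ih _ (Finset.erase_ssubset hne.choose_spec) (by omega)
      rw [etaVec, etaFn_choose _ _ _ hne, etaFn_zero, Pi.add_apply, ih']
      simp [Pi.single_eq_of_ne hCD]

theorem IsPseudoRootRing.etaVec_mem_degOne (h : IsPseudoRootRing r π) (D C : Finset ι) :
    etaVec r D C ∈ degOne π := by
  induction D using Finset.strongInduction with
  | H D ih =>
    rcases D.eq_empty_or_nonempty with rfl | hne
    · rw [etaVec, etaFn_empty]; exact zero_mem _
    · rw [etaVec, etaFn_choose _ _ _ hne, etaFn_zero, Pi.add_apply]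
      exact add_mem (ih _ (Finset.erase_ssubset hne.choose_spec))
        (smul_single_mem_degOne (sub_mem (h.mem_degOne _) (h.mem_degOne _)) _ _)

theorem pseudoRel_mkQ_relSpan (r : Finset ι → R) (q : ℕ) :
    PseudoRel r (fun C => (relSpan r q).mkQ (Pi.single C 1)) q := by
  intro C hC i hi j hj
  rw [← map_sub, ← map_sub, ← map_smul, ← map_smul, ← sub_eq_zero, ← map_sub,
    Submodule.mkQ_apply, Submodule.Quotient.mk_eq_zero]
  exact Submodule.subset_span ⟨C, i, j, hC, hi, hj, rfl⟩

/-- The combination of the principal parts of relations with coefficients `a`. -/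
def principalSum (r : Finset ι → R) (a : Finset ι → Finset ι → R) : Finset ι → R :=
  ∑ C, ∑ D, a C D • (r D • Pi.single C 1 - etaVec r D)

theorem IsPseudoRootRing.relVec_sub_mem (h : IsPseudoRootRing r π) {q : ℕ} {C : Finset ι}
    {i j : ι} (hC : C.card = q + 1) (hi : i ∈ C) (hj : j ∈ C) :
    relVec r C i j - ((r (C.erase i) • Pi.single C 1 - etaVec r (C.erase i)) -
      (r (C.erase j) • Pi.single C 1 - etaVec r (C.erase j))) ∈ relSpan r q := by
  by_cases hij : i = j
  · subst hij; simp [relVec]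
  have hci := Finset.card_erase_of_mem hi
  have hcj := Finset.card_erase_of_mem hj
  have e1 := etaFn_succ (h.rel q) (pseudoRel_mkQ_relSpan r q) 0 (C.erase i) (by omega) j
    (Finset.mem_erase.2 ⟨Ne.symm hij, hj⟩)
  have e2 := etaFn_succ (h.rel q) (pseudoRel_mkQ_relSpan r q) 0 (C.erase j) (by omega) i
    (Finset.mem_erase.2 ⟨hij, hi⟩)
  rw [Finset.erase_right_comm] at e2
  simp only [etaFn_map, etaFn_zero, zero_add] at e1 e2
  rw [← Submodule.Quotient.mk_eq_zero, ← Submodule.mkQ_apply]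
  simp only [relVec, map_sub, map_smul, etaVec, e1, e2, smul_sub, sub_smul]
  abel

theorem IsPseudoRootRing.exists_principalSum (h : IsPseudoRootRing r π) {q : ℕ}
    {v : Finset ι → R} (hv : v ∈ relSpan r (q + 1)) :
    ∃ a : Finset ι → Finset ι → R,
      (∀ C D, ¬ (C.card = q + 1 ∧ D.card = q) → a C D = 0) ∧
      (∀ C, ∑ D, a C D = 0) ∧ v - principalSum r a ∈ relSpan r q := by
  induction hv using Submodule.span_induction with
  | zero => exact ⟨0, by simp, by simp, by simp [principalSum]⟩
  | add x y _ _ hx hy =>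
    obtain ⟨a, ha, ha0, hax⟩ := hx
    obtain ⟨b, hb, hb0, hby⟩ := hy
    refine ⟨a + b, fun C D hCD => by simp [ha C D hCD, hb C D hCD],
      fun C => by simp [Finset.sum_add_distrib, ha0, hb0], ?_⟩
    have : principalSum r (a + b) = principalSum r a + principalSum r b := by
      simp only [principalSum, Pi.add_apply, add_smul, Finset.sum_add_distrib]
    rw [this, add_sub_add_comm]
    exact add_mem hax hby
  | smul c x _ hx =>
    obtain ⟨a, ha, ha0, hax⟩ := hx
    refine ⟨fun C D => c * a C D, fun C D hCD => by simp [ha C D hCD],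
      fun C => by rw [← Finset.mul_sum, ha0, mul_zero], ?_⟩
    have : principalSum r (fun C D => c * a C D) = c • principalSum r a := by
      simp only [principalSum, mul_smul, Finset.smul_sum]
    rw [this, ← smul_sub]
    exact Submodule.smul_mem _ _ hax
  | mem x hx =>
    obtain ⟨C, i, j, hC, hi, hj, rfl⟩ := hx
    by_cases hCq : C.card = q + 1
    · refine ⟨Pi.single C (Pi.single (C.erase i) 1 - Pi.single (C.erase j) 1), ?_, ?_, ?_⟩
      · intro C' D hCD
        by_cases hC' : C' = C
        · subst hC'
          have hci := Finset.card_erase_of_mem hi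
          have hcj := Finset.card_erase_of_mem hj
          have h1 : D ≠ C'.erase i := by rintro rfl; exact hCD ⟨hCq, by omega⟩
          have h2 : D ≠ C'.erase j := by rintro rfl; exact hCD ⟨hCq, by omega⟩
          simp [Pi.single_eq_of_ne h1, Pi.single_eq_of_ne h2]
        · simp [Pi.single_eq_of_ne hC']
      · intro C'
        by_cases hC' : C' = C
        · subst hC'; simp
        · simp [Pi.single_eq_of_ne hC']
      · have : principalSum r (Pi.single C (Pi.single (C.erase i) 1 - Pi.single (C.erase j) 1)) =
            (r (C.erase i) • Pi.single C 1 - etaVec r (C.erase i)) -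
            (r (C.erase j) • Pi.single C 1 - etaVec r (C.erase j)) := by
          rw [principalSum, Finset.sum_eq_single C]
          · simp only [Pi.single_eq_same, Pi.sub_apply, sub_smul, Finset.sum_sub_distrib]
            congr 1 <;> simp [Pi.single_apply, ite_smul]
          · intro C' _ hC'
            simp [Pi.single_eq_of_ne hC']
          · simp
        rw [this]
        exact h.relVec_sub_mem hCq hi hj
    · refine ⟨0, by simp, by simp, ?_⟩
      have : principalSum r 0 = 0 := by simp [principalSum]
      rw [this, sub_zero]
      exact Submodule.subset_span ⟨C, i, j, by omega, hi, hj, rfl⟩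

theorem principalSum_apply {q : ℕ} {a : Finset ι → Finset ι → R}
    (ha : ∀ C D, ¬ (C.card = q + 1 ∧ D.card = q) → a C D = 0) {C : Finset ι}
    (hC : C.card = q + 1) : principalSum r a C = ∑ D, a C D * r D := by
  rw [principalSum, Finset.sum_apply, Finset.sum_eq_single C]
  · rw [Finset.sum_apply]
    refine Finset.sum_congr rfl fun D _ => ?_
    by_cases hD : D.card = q
    · simp [etaVec_apply_of_card_lt (r := r) (show D.card < C.card by omega)]
    · simp [ha C D fun h' => hD h'.2]
  · intro C' _ hC'
    rw [Finset.sum_apply]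
    refine Finset.sum_eq_zero fun D _ => ?_
    by_cases hD : D.card = q
    · simp [etaVec_apply_of_card_lt (r := r) (show D.card < C.card by omega),
        Pi.single_eq_of_ne (Ne.symm hC')]
    · simp [ha C' D fun h' => hD h'.2]
  · simp

/-- Relations that only involve small sets follow, degree by degree, from those attached to
small sets. -/
theorem IsPseudoRootRing.compLeft_mem_relSpan_of_succ (h : IsPseudoRootRing r π) {d : ℕ}
    (H : ∀ e < d, TopCoeff r π e) {q : ℕ} {b : Finset ι → R} (hb : b ∈ relSpan r (q + 1))
    (hbq : ∀ C, q < C.card → b C = 0) :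
    (π d).compLeft (Finset ι) b ∈ relSpan r q := by
  obtain ⟨a, ha, ha0, hab⟩ := h.exists_principalSum hb
  have hlin : ∀ C D, ∀ E, (r D • (Pi.single C 1 : Finset ι → R) - etaVec r D) E ∈ degOne π :=
    fun C D E => sub_mem (smul_single_mem_degOne (h.mem_degOne D) C E) (h.etaVec_mem_degOne D E)
  have hproj := h.compLeft_mem_relSpan hab d
  rw [map_sub] at hproj
  suffices hs : (π d).compLeft (Finset ι) (principalSum r a) ∈ relSpan r q by
    simpa using add_mem hproj hs
  cases d with
  | zero =>
    rw [principalSum, map_sum]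
    refine Submodule.sum_mem _ fun C _ => ?_
    rw [map_sum]
    refine Submodule.sum_mem _ fun D _ => ?_
    rw [compLeft_zero_smul (hlin C D)]
    exact zero_mem _
  | succ e =>
    have hcoef : ∀ C, ∑ D, a C D * r D = 0 := by
      intro C
      by_cases hC : C.card = q + 1
      · have := relSpan_apply_of_card_lt hab (show q < C.card by omega)
        rw [Pi.sub_apply, hbq C (by omega), zero_sub, neg_eq_zero] at this
        rw [← principalSum_apply ha hC, this]
      · exact Finset.sum_eq_zero fun D _ => by simp [ha C D fun h' => hC h'.1]
    rw [principalSum, map_sum]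
    refine Submodule.sum_mem _ fun C _ => ?_
    have hsyz := h.syzygy (pseudoRel_mkQ_relSpan r q) e (fun e' he' => H e' (by omega)) 0 q le_rfl
      (a C) (fun D hD => ha C D fun h' => hD h'.2) (ha0 C) (hcoef C)
    rw [Finset.sum_congr rfl fun D _ => by rw [etaFn_map, ← map_smul], ← map_sum,
      Submodule.mkQ_apply, Submodule.Quotient.mk_eq_zero] at hsyz
    have hz : ∑ D, π e (a C D) • (r D • (Pi.single C 1 : Finset ι → R)) = 0 := by
      simp only [smul_smul]
      rw [← Finset.sum_smul, ← h.proj_succ_sum, hcoef, map_zero, zero_smul]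
    rw [map_sum, Finset.sum_congr rfl fun D _ => compLeft_succ_smul (hlin C D) e (a C D)]
    simp only [smul_sub, Finset.sum_sub_distrib]
    rw [hz, zero_sub]
    exact neg_mem hsyz

theorem relSpan_apply_mem_facetIdeal {v : Finset ι → R} {A : Finset ι}
    (hv : v ∈ relSpan r A.card) (hA : A.Nonempty) : v A ∈ facetIdeal r A := by
  have : relSpan r A.card ≤ Submodule.comap
      (LinearMap.proj (R := R) (φ := fun _ : Finset ι => R) A) (facetIdeal r A) := by
    refine Submodule.span_le.2 ?_
    rintro _ ⟨C, i, j, hC, hi, hj, rfl⟩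
    have h1 : ∀ i ∈ C, A ≠ C.erase i := by
      rintro i hi rfl
      have := Finset.card_erase_lt_of_mem hi
      omega
    change relVec r C i j A ∈ facetIdeal r A
    by_cases hAC : A = C
    · subst hAC
      have : relVec r A i j A = r (A.erase i) - r (A.erase j) := by
        simp [relVec, Pi.single_eq_of_ne (h1 i hi), Pi.single_eq_of_ne (h1 j hj)]
      rw [this]
      exact sub_mem_diffIdeal ⟨Finset.erase_subset _ _, Finset.card_erase_add_one hi⟩
        ⟨Finset.erase_subset _ _, Finset.card_erase_add_one hj⟩
    · have : relVec r C i j A = 0 := by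
        simp [relVec, Pi.single_eq_of_ne (h1 i hi), Pi.single_eq_of_ne (h1 j hj),
          Pi.single_eq_of_ne hAC]
      rw [this]; exact zero_mem _
  exact this hv

theorem IsPseudoRootRing.topCoeff (h : IsPseudoRootRing r π) (d : ℕ) : TopCoeff r π d := by
  induction d using Nat.strong_induction_on with
  | _ d H =>
    intro b A hA hbA hb
    set b' : Finset ι → R := (π d).compLeft (Finset ι) (Function.update b ∅ 0) with hb'
    have hA' := Finset.card_pos.2 hA
    have hsupp : ∀ C, A.card < C.card → Function.update b ∅ 0 C = 0 := by
      intro C hC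
      rw [Function.update_of_ne, hbA C hC]
      rintro rfl; simp at hC
    have hsupp' : ∀ C, A.card < C.card → b' C = 0 := by
      intro C hC
      rw [hb', AddMonoidHom.compLeft_apply, Function.comp_apply, hsupp C hC, map_zero]
    have hall : Function.update b ∅ 0 ∈ relSpan r (Fintype.card ι) := by
      refine h.pres _ (by simp) ?_
      rw [← hb]
      refine Finset.sum_congr rfl fun C _ => ?_
      by_cases hC : C = ∅
      · subst hC; simp [h.empty]
      · rw [Function.update_of_ne hC]
    have hidem : (π d).compLeft (Finset ι) b' = b' := by
      ext C; exact h.proj_proj _ _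
    have hdesc : ∀ q, b' ∈ relSpan r (A.card + q) → b' ∈ relSpan r A.card := by
      intro q
      induction q with
      | zero => exact id
      | succ q ih =>
        intro hq
        refine ih ?_
        rw [← hidem]
        exact h.compLeft_mem_relSpan_of_succ H hq fun C hC => hsupp' C (by omega)
    have hle := Finset.card_le_univ A
    have hmem : b' ∈ relSpan r A.card := by
      refine hdesc (Fintype.card ι - A.card) ?_
      rw [Nat.add_sub_cancel' hle]
      exact h.compLeft_mem_relSpan hall d
    have := relSpan_apply_mem_facetIdeal hmem hA
    rwa [hb', AddMonoidHom.compLeft_apply, Function.comp_apply,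
      Function.update_of_ne hA.ne_empty] at this


theorem IsPseudoRootRing.coeff_mem (h : IsPseudoRootRing r π) {b : Finset ι → R} {A : Finset ι}
    (hA : A.Nonempty) (hb : ∀ C, A.card < C.card → b C = 0) (hbr : ∑ C, b C * r C = 0) :
    b A ∈ facetIdeal r A :=
  h.mem_of_proj fun d => h.topCoeff d b A hA hb hbr

theorem IsPseudoRootRing.homogeneous_coeff_mem (h : IsPseudoRootRing r π) {q : ℕ}
    {a : Finset ι → R} (ha : ∀ C, C.card ≠ q → a C = 0) (ha0 : ∑ C, a C = 0)
    (har : ∑ C, a C * r C = 0) (C : Finset ι) : a C ∈ facetIdeal r C := by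
  refine h.mem_of_proj fun d => ?_
  obtain ⟨g, hg, hg0, hgr⟩ :=
    exists_facet_coeff (π := π) (d := d) le_rfl (fun e _ => h.topCoeff e) ha ha0 har C
  exact ⟨g, fun E hE => hg E fun hE' => hE hE'.1, hg0, hgr⟩

theorem IsPseudoRootRing.sum_smul_etaFn_eq_zero {M : Type*} [AddCommGroup M] [Module R M]
    (h : IsPseudoRootRing r π) {m : Finset ι → M} {p : ℕ} (hm : PseudoRel r m p) (k q : ℕ)
    (hq : q ≤ p) {a : Finset ι → R} (ha : ∀ C, C.card ≠ q → a C = 0) (ha0 : ∑ C, a C = 0)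
    (har : ∑ C, a C * r C = 0) : ∑ C, a C • etaFn r m (k + 1) C = 0 := by
  choose N hN using fun C => h.sum_proj (a C)
  have : ∀ C, a C = ∑ d ∈ Finset.range (∑ C, N C), π d (a C) := fun C =>
    (hN C _ (Finset.single_le_sum (f := N) (fun _ _ => Nat.zero_le _) (Finset.mem_univ C))).symm
  rw [Finset.sum_congr rfl fun C _ => by rw [this C, Finset.sum_smul], Finset.sum_comm]
  exact Finset.sum_eq_zero fun d _ =>
    h.syzygy hm d (fun e _ => h.topCoeff e) k q hq a ha ha0 har

theorem IsPseudoRootRing.sum_mul_eq_zero (h : IsPseudoRootRing r π) {p : ℕ} {w : Finset ι → R}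
    (hw : ∀ C, C.card ≠ p → w C = 0) (hw0 : ∑ C, w C = 0) (hwf : ∀ C, w C ∈ facetIdeal r C) :
    ∑ C, w C * r C = 0 := by
  have hex : ∀ C, ∃ g : Finset ι → R,
      (∀ E, ¬ ((E ⊆ C ∧ E.card + 1 = C.card) ∧ C.card = p) → g E = 0) ∧
      ∑ E, g E = 0 ∧ ∑ E, g E * r E = w C := by
    intro C
    by_cases hC : C.card = p
    · obtain ⟨g, hg, hg'⟩ := hwf C
      exact ⟨g, fun E hE => hg E fun hE' => hE ⟨hE', hC⟩, hg'⟩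
    · exact ⟨0, by simp, by simp, by simp [hw C hC]⟩
  choose g hg hg0 hgr using hex
  have step : ∀ C, w C * r C = ∑ E, g C E • etaFn r r 1 E := by
    intro C
    by_cases hC : C.card = p
    · have := facet_smul_etaFn (h.rel p) (h.rel p) 0 hC.le
        (fun E hE => hg C E fun hE' => hE hE'.1) (hg0 C)
      rwa [hgr, etaFn_zero, smul_eq_mul] at this
    · have : ∀ E, g C E = 0 := fun E => hg C E fun hE' => hC hE'.2
      simp [hw C hC, this]
  rw [Finset.sum_congr rfl fun C _ => step C, Finset.sum_comm,
    Finset.sum_congr rfl fun E _ => (Finset.sum_smul).symm]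
  refine h.sum_smul_etaFn_eq_zero (h.rel p) 0 (p - 1) (by omega)
    (fun E hE => Finset.sum_eq_zero fun D _ => hg D E fun hE' => hE (by omega)) ?_ ?_
  · rw [Finset.sum_comm]; exact Finset.sum_eq_zero fun D _ => hg0 D
  · simp only [Finset.sum_mul]
    rw [Finset.sum_comm, Finset.sum_congr rfl fun D _ => hgr D, hw0]

/-! ### Subcomplexes of a simplex generated by facets -/

/-- The sum of the facet ideals of the sets in `Y`. -/
def facetSum (r : Finset ι → R) (Y : Set (Finset ι)) : Ideal R where
  carrier := {x | ∃ v : Finset ι → R, (∀ C, C ∉ Y → v C = 0) ∧ (∀ C, v C ∈ facetIdeal r C) ∧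
    ∑ C, v C = x}
  zero_mem' := ⟨0, by simp⟩
  add_mem' := by
    rintro _ _ ⟨a, ha, haf, rfl⟩ ⟨b, hb, hbf, rfl⟩
    exact ⟨a + b, fun C hC => by simp [ha C hC, hb C hC], fun C => add_mem (haf C) (hbf C),
      by simp [Finset.sum_add_distrib]⟩
  smul_mem' := by
    rintro c _ ⟨a, ha, haf, rfl⟩
    exact ⟨fun C => c * a C, fun C hC => by simp [ha C hC],
      fun C => Ideal.mul_mem_left _ _ (haf C), by simp [Finset.mul_sum]⟩

theorem facetIdeal_le_facetSum {Y : Set (Finset ι)} {C : Finset ι} (hC : C ∈ Y) :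
    facetIdeal r C ≤ facetSum r Y := by
  intro x hx
  refine ⟨Pi.single C x, fun D hD => Pi.single_eq_of_ne (by rintro rfl; exact hD hC) _,
    fun D => ?_, by simp⟩
  by_cases hD : D = C
  · subst hD; simpa using hx
  · rw [Pi.single_eq_of_ne hD]; exact zero_mem _

theorem sub_mem_of_simplex {I : Ideal R} {G : Finset ι} {p : ℕ}
    (hI : ∀ C ⊆ G, C.card = p + 1 → facetIdeal r C ≤ I) {E E' : Finset ι} (hE : E ⊆ G)
    (hE' : E' ⊆ G) (hp : E.card = p) (hp' : E'.card = p) : r E - r E' ∈ I := by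
  induction hn : (E \ E').card generalizing E with
  | zero =>
    have : E = E' := Finset.eq_of_subset_of_card_le
      (Finset.sdiff_eq_empty_iff_subset.1 (Finset.card_eq_zero.1 hn)) (by omega)
    simp [this]
  | succ n ih =>
    obtain ⟨e, he⟩ := Finset.card_pos.1 (show 0 < (E \ E').card by omega)
    have hcard : (E' \ E).card = (E \ E').card := by
      have := Finset.card_sdiff_add_card E E'
      have := Finset.card_sdiff_add_card E' E
      rw [Finset.union_comm] at this
      omega
    obtain ⟨e', he'⟩ := Finset.card_pos.1 (show 0 < (E' \ E).card by omega)
    rw [Finset.mem_sdiff] at he he'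
    have hne : e' ≠ e := by rintro rfl; exact he.2 he'.1
    have hcC : (insert e' E).card = p + 1 := by rw [Finset.card_insert_of_notMem he'.2, hp]
    have hc1 : ((insert e' E).erase e).card = p := by
      rw [Finset.card_erase_of_mem (Finset.mem_insert_of_mem he.1), hcC]; rfl
    have hsub : insert e' E ⊆ G := Finset.insert_subset (hE' he'.1) hE
    have h1 : r E - r ((insert e' E).erase e) ∈ I :=
      hI _ hsub hcC (sub_mem_diffIdeal ⟨Finset.subset_insert _ _, by omega⟩
        ⟨Finset.erase_subset _ _, by omega⟩)
    have h2 : r ((insert e' E).erase e) - r E' ∈ I := by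
      refine ih ((Finset.erase_subset _ _).trans hsub) hc1 ?_
      have : (insert e' E).erase e \ E' = (E \ E').erase e := by
        ext x
        simp only [Finset.mem_sdiff, Finset.mem_erase, Finset.mem_insert]
        constructor
        · rintro ⟨⟨h1, rfl | h2⟩, h3⟩
          · exact absurd he'.1 h3
          · exact ⟨h1, h2, h3⟩
        · rintro ⟨h1, h2, h3⟩
          exact ⟨⟨h1, Or.inr h2⟩, h3⟩
      rw [this, Finset.card_erase_of_mem (Finset.mem_sdiff.2 he), hn]; rfl
    simpa using add_mem h1 h2

/-- The faces of cardinality `p` of the simplex `A` that do not contain `S`. -/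
abbrev faces (A S : Finset ι) (p : ℕ) : Set (Finset ι) := {C | C ⊆ A ∧ ¬ S ⊆ C ∧ C.card = p}

theorem facetIdeal_le_diffIdeal_faces {A S C : Finset ι} {p : ℕ} (hC : C ∈ faces A S (p + 1)) :
    facetIdeal r C ≤ diffIdeal r (faces A S p) :=
  diffIdeal_mono fun E hE => ⟨hE.1.trans hC.1, fun h => hC.2.1 (h.trans hE.1), by
    have := hE.2; have := hC.2.2; omega⟩

theorem diffIdeal_faces_le_facetSum {D S : Finset ι} {p : ℕ} (hp : p + 2 ≤ D.card) :
    diffIdeal r (faces D S p) ≤ facetSum r (faces D S (p + 1)) := by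
  by_cases hemp : (faces D S p).Nonempty
  swap
  · exact diffIdeal_le (D := ∅) fun C hC => absurd ⟨C, hC⟩ hemp
  obtain ⟨E', hE'⟩ := hemp
  refine diffIdeal_le (D := E') fun E hE => ?_
  obtain ⟨s, hs, hsE⟩ := Finset.not_subset.1 hE.2.1
  obtain ⟨s', hs', hsE'⟩ := Finset.not_subset.1 hE'.2.1
  have hcard : p ≤ ((D.erase s).erase s').card := by
    have := Finset.pred_card_le_card_erase (s := D) (a := s)
    have := Finset.pred_card_le_card_erase (s := D.erase s) (a := s')
    omega
  obtain ⟨E₀, hE₀, hE₀p⟩ := Finset.exists_subset_card_eq hcard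
  have key : ∀ s ∈ S, ∀ C ⊆ D.erase s, C.card = p + 1 →
      facetIdeal r C ≤ facetSum r (faces D S (p + 1)) := fun s hs C hC hCp =>
    facetIdeal_le_facetSum ⟨hC.trans (Finset.erase_subset _ _),
      fun h => Finset.notMem_erase s D (hC (h hs)), hCp⟩
  have h1 : r E - r E₀ ∈ facetSum r (faces D S (p + 1)) :=
    sub_mem_of_simplex (key s hs) (Finset.subset_erase.2 ⟨hE.1, hsE⟩)
      (hE₀.trans (Finset.erase_subset _ _)) hE.2.2 hE₀p
  have h2 : r E₀ - r E' ∈ facetSum r (faces D S (p + 1)) :=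
    sub_mem_of_simplex (key s' hs')
      (hE₀.trans (Finset.erase_subset_erase _ (Finset.erase_subset _ _)))
      (Finset.subset_erase.2 ⟨hE'.1, hsE'⟩) hE₀p hE'.2.2
  simpa using add_mem h1 h2

open Classical in
theorem IsPseudoRootRing.proj_mem_faces (h : IsPseudoRootRing r π) {A D S : Finset ι}
    (hDA : D ⊆ A) (d p : ℕ) (hp : p + 1 ≤ D.card) {x : R}
    (hxD : x ∈ diffIdeal r {C | C ⊆ D ∧ C.card = p}) (hxA : x ∈ diffIdeal r (faces A S p)) :
    π d x ∈ diffIdeal r (faces D S p) := by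
  induction d generalizing p x with
  | zero =>
    obtain ⟨b, -, -, rfl⟩ := hxD
    rw [h.proj_zero_sum]; exact zero_mem _
  | succ e ih =>
    obtain ⟨b, hb, hb0, hbx⟩ := hxD
    obtain ⟨b', hb', hb0', hbx'⟩ := hxA
    cases p with
    | zero =>
      have : x = 0 := by
        rw [← hbx]
        refine Finset.sum_eq_zero fun C _ => ?_
        by_cases hC : C = ∅
        · rw [hC, h.empty, mul_zero]
        · rw [hb C fun hC' => hC (Finset.card_eq_zero.1 hC'.2), zero_mul]
      rw [this, map_zero]; exact zero_mem _
    | succ q =>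
      have hdiff : ∀ C, (b - b') C ∈ facetIdeal r C := by
        refine h.homogeneous_coeff_mem (q := q + 1) (fun C hC => ?_) ?_ ?_
        · rw [Pi.sub_apply, hb C fun h => hC h.2, hb' C fun h => hC h.2.2, sub_zero]
        · simp [hb0, hb0']
        · simp [sub_mul, hbx, hbx']
      have hb1 : ∀ C, C ∉ faces D S (q + 1) → C ⊆ D → C.card = q + 1 → b C ∈ facetIdeal r C := by
        intro C hC hCD hCq
        have := hdiff C
        rwa [Pi.sub_apply, hb' C fun h => hC ⟨hCD, h.2⟩, sub_zero] at this
      set β : R := ∑ C, if C ∈ faces D S (q + 1) then b C else 0 with hβ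
      have hβD : β ∈ diffIdeal r {C | C ⊆ D ∧ C.card = q} := by
        have : β = -∑ C, if C ∈ faces D S (q + 1) then 0 else b C := by
          rw [eq_neg_iff_add_eq_zero, hβ, ← Finset.sum_add_distrib]
          exact (Finset.sum_congr rfl fun C _ => by split_ifs <;> simp).trans hb0
        rw [this]
        refine neg_mem (Submodule.sum_mem _ fun C _ => ?_)
        split_ifs with hC
        · exact zero_mem _
        · by_cases hCD : C ⊆ D ∧ C.card = q + 1
          · have hsub : {E | E ⊆ C ∧ E.card + 1 = C.card} ⊆ {E | E ⊆ D ∧ E.card = q} :=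
              fun E hE => ⟨hE.1.trans hCD.1, by have := hE.2; have := hCD.2; omega⟩
            exact diffIdeal_mono hsub (hb1 C hC hCD.1 hCD.2)
          · rw [hb C hCD]; exact zero_mem _
      have hβA : β ∈ diffIdeal r (faces A S q) := by
        have : β = ∑ C, if C ∈ faces D S (q + 1) then (b - b') C else -b' C := by
          rw [← sub_zero β, ← hb0', hβ, ← Finset.sum_sub_distrib]
          exact Finset.sum_congr rfl fun C _ => by split_ifs <;> simp
        rw [this]
        refine Submodule.sum_mem _ fun C _ => ?_
        split_ifs with hC
        · exact facetIdeal_le_diffIdeal_faces ⟨hC.1.trans hDA, hC.2⟩ (hdiff C)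
        · by_cases hCA : C ∈ faces A S (q + 1)
          · have := hdiff C
            rw [Pi.sub_apply, hb C fun hC' => hC ⟨hC'.1, hCA.2⟩, zero_sub] at this
            exact facetIdeal_le_diffIdeal_faces hCA this
          · rw [hb' C hCA, neg_zero]; exact zero_mem _
      obtain ⟨v, hv, hvf, hvβ⟩ :=
        diffIdeal_faces_le_facetSum (by omega) (ih q (by omega) hβD hβA)
      set u : Finset ι → R := fun C => (if C ∈ faces D S (q + 1) then π e (b C) else 0) - v C
        with hu
      have hu0 : ∑ C, u C = 0 := by
        rw [hu, Finset.sum_sub_distrib, hvβ, hβ, map_sum, sub_eq_zero]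
        exact Finset.sum_congr rfl fun C _ => by split_ifs <;> simp
      have huY : ∀ C, C ∉ faces D S (q + 1) → u C = 0 := fun C hC => by
        simp only [hu, if_neg hC, hv C hC, sub_zero]
      have hw := h.sum_mul_eq_zero (p := q + 1) (w := fun C => π e (b C) - u C)
        (fun C hC => by
          rw [hb C fun h => hC h.2, huY C fun h => hC h.2.2, map_zero, sub_zero])
        (by rw [Finset.sum_sub_distrib, hu0, ← map_sum, hb0, map_zero, sub_zero])
        (fun C => by
          by_cases hC : C ∈ faces D S (q + 1)
          · simpa only [hu, if_pos hC, sub_sub_cancel] using hvf C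
          · rw [huY C hC, sub_zero]
            by_cases hCD : C ⊆ D ∧ C.card = q + 1
            · exact h.proj_mem (hb1 C hC hCD.1 hCD.2) e
            · rw [hb C hCD, map_zero]; exact zero_mem _)
      refine ⟨u, huY, hu0, ?_⟩
      rw [← hbx, h.proj_succ_sum]
      simp only [sub_mul, Finset.sum_sub_distrib] at hw
      exact (sub_eq_zero.1 hw).symm

/-- The left ideal of differences of the facets of `A` opposite to elements of `S`. -/
abbrev partialFacetIdeal (r : Finset ι → R) (A S : Finset ι) : Ideal R :=
  diffIdeal r (faces A S (A.card - 1))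

theorem IsPseudoRootRing.mul_mem_partialFacetIdeal (h : IsPseudoRootRing r π) {A S : Finset ι}
    {s t : ι} (hSA : S ⊆ A) (ht : t ∈ A) (htS : t ∉ S) (hs : s ∈ S) {x : R}
    (hx : x ∈ partialFacetIdeal r (A.erase t) S) :
    x * (r (A.erase t) - r (A.erase s)) ∈ partialFacetIdeal r A S := by
  have hst : s ≠ t := by rintro rfl; exact htS hs
  have hsA := hSA hs
  have hcard := Finset.card_erase_of_mem ht
  have hpos := Finset.card_pos.2 ⟨s, Finset.mem_erase.2 ⟨hst, hsA⟩⟩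
  have hface : ∀ u ∈ S, A.erase u ∈ faces A S (A.card - 1) := fun u hu =>
    ⟨Finset.erase_subset _ _, fun h' => Finset.notMem_erase u A (h' hu),
      Finset.card_erase_of_mem (hSA hu)⟩
  suffices hle : partialFacetIdeal r (A.erase t) S ≤ Submodule.comap
      (LinearMap.toSpanSingleton R R (r (A.erase t) - r (A.erase s))) (partialFacetIdeal r A S) from
    hle hx
  refine diffIdeal_le (D := (A.erase t).erase s) fun C hC => ?_
  obtain ⟨hC1, hC2, hC3⟩ := hC
  obtain ⟨u, hu, rfl⟩ := exists_erase_of_facet hC1 (by omega)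
  have huS : u ∈ S := by
    by_contra huS
    exact hC2 (Finset.subset_erase.2 ⟨Finset.subset_erase.2 ⟨hSA, htS⟩, huS⟩)
  change (r ((A.erase t).erase u) - r ((A.erase t).erase s)) * (r (A.erase t) - r (A.erase s)) ∈
    partialFacetIdeal r A S
  by_cases hus : u = s
  · subst hus; simp
  have hut := Finset.ne_of_mem_erase hu
  have huA := Finset.mem_of_mem_erase hu
  have step : ∀ i ∈ A, ∀ j ∈ A, i ≠ j →
      (r ((A.erase i).erase j)) * r (A.erase i) - etaFn r r 1 ((A.erase i).erase j) =
        r (A.erase i) * r (A.erase i) - etaFn r r 1 (A.erase i) := by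
    intro i hi j hj hij
    have := etaFn_succ (h.rel A.card) (h.rel A.card) 0 (A.erase i)
      (Finset.card_le_card (Finset.erase_subset _ _)) j (Finset.mem_erase.2 ⟨hij.symm, hj⟩)
    rw [zero_add] at this
    rw [this, etaFn_zero, smul_eq_mul, sub_mul]
    abel
  have e1 := step t ht u huA (Ne.symm hut)
  have e2 := step t ht s hsA (Ne.symm hst)
  have e3 := step u huA t ht hut
  have e4 := step u huA s hsA hus
  have e5 := step s hsA t ht hst
  have e6 := step s hsA u huA (Ne.symm hus)
  rw [Finset.erase_right_comm] at e3 e5 e6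
  have : (r ((A.erase t).erase u) - r ((A.erase t).erase s)) * (r (A.erase t) - r (A.erase s)) =
      (r ((A.erase t).erase u) - r ((A.erase u).erase s)) * (r (A.erase u) - r (A.erase s)) := by
    have k1 := sub_eq_sub_iff_sub_eq_sub.1 (e1.trans e2.symm)
    have k2 := sub_eq_sub_iff_sub_eq_sub.1 (e3.trans e4.symm)
    have k3 := sub_eq_sub_iff_sub_eq_sub.1 (e5.trans e6.symm)
    simp only [mul_sub, sub_mul]
    have : r ((A.erase t).erase u) * r (A.erase t) - r ((A.erase t).erase s) * r (A.erase t) -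
        (r ((A.erase t).erase u) * r (A.erase u) - r ((A.erase u).erase s) * r (A.erase u)) +
        (r ((A.erase t).erase s) * r (A.erase s) -
          r ((A.erase u).erase s) * r (A.erase s)) = 0 := by
      rw [k1, k2, k3]; abel
    rw [← sub_eq_zero, ← this]
    abel
  rw [this]
  exact Ideal.mul_mem_left _ _ (sub_mem_diffIdeal (hface u huS) (hface s hs))

theorem IsPseudoRootRing.mem_partialFacetIdeal_of_mul_mem (h : IsPseudoRootRing r π)
    {A S : Finset ι} {s t : ι} (hSA : S ⊆ A) (ht : t ∈ A) (htS : t ∉ S) (hs : s ∈ S) {x : R}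
    (hx : x * (r (A.erase t) - r (A.erase s)) ∈ partialFacetIdeal r A S) :
    x ∈ partialFacetIdeal r (A.erase t) S := by
  have hst : s ≠ t := by rintro rfl; exact htS hs
  have hsA := hSA hs
  have hSt : S ⊆ A.erase t := Finset.subset_erase.2 ⟨hSA, htS⟩
  have hcard := Finset.card_erase_of_mem ht
  have hcards := Finset.card_erase_of_mem hsA
  have hpos := Finset.card_pos.2 ⟨s, hSt hs⟩
  obtain ⟨b, hb, hb0, hbx⟩ := hx
  set a : Finset ι → R := Pi.single (A.erase t) x - Pi.single (A.erase s) x - b with ha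
  have hst' : A.erase t ≠ A.erase s := fun he =>
    Finset.notMem_erase t A (he ▸ Finset.mem_erase.2 ⟨hst.symm, ht⟩)
  have haf : ∀ C, a C ∈ facetIdeal r C := by
    refine h.homogeneous_coeff_mem (q := A.card - 1) (fun C hC => ?_) ?_ ?_
    · have h1 : C ≠ A.erase t := by rintro rfl; exact hC hcard
      have h2 : C ≠ A.erase s := by rintro rfl; exact hC hcards
      simp [ha, Pi.single_eq_of_ne h1, Pi.single_eq_of_ne h2, hb C fun h' => hC h'.2.2]
    · simp [ha, hb0]
    · simp only [ha, Pi.sub_apply, sub_mul, Finset.sum_sub_distrib, hbx]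
      simp [Pi.single_apply, ite_mul, mul_sub]
  have hat : a (A.erase t) = x := by
    simp [ha, Pi.single_eq_of_ne hst', hb (A.erase t) fun h' => h'.2.1 hSt]
  have hxD : x ∈ diffIdeal r {C | C ⊆ A.erase t ∧ C.card = (A.erase t).card - 1} := by
    have hsub : {C | C ⊆ A.erase t ∧ C.card + 1 = (A.erase t).card} ⊆
        {C | C ⊆ A.erase t ∧ C.card = (A.erase t).card - 1} :=
      fun C hC => ⟨hC.1, by have := hC.2; omega⟩
    exact diffIdeal_mono hsub (hat ▸ haf (A.erase t))
  have hxA : x ∈ diffIdeal r (faces A S ((A.erase t).card - 1)) := by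
    have hsum : ∑ C, a C = 0 := by simp [ha, hb0]
    rw [← Finset.add_sum_erase _ _ (Finset.mem_univ (A.erase t)), hat] at hsum
    rw [eq_neg_of_add_eq_zero_left hsum]
    refine neg_mem (Submodule.sum_mem _ fun C hC => ?_)
    have hCt := Finset.ne_of_mem_erase hC
    have hsf : A.erase s ∈ faces A S (A.card - 1) :=
      ⟨Finset.erase_subset _ _, fun h' => Finset.notMem_erase s A (h' hs), hcards⟩
    by_cases hCf : C ∈ faces A S (A.card - 1)
    · refine facetIdeal_le_diffIdeal_faces ?_ (haf C)
      rwa [show (A.erase t).card - 1 + 1 = A.card - 1 by omega]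
    · have hCs : C ≠ A.erase s := by rintro rfl; exact hCf hsf
      have : a C = 0 := by
        simp [ha, Pi.single_eq_of_ne hCt, Pi.single_eq_of_ne hCs, hb C hCf]
      rw [this]; exact zero_mem _
  exact h.mem_of_proj fun d =>
    h.proj_mem_faces (Finset.erase_subset _ _) d _ (by omega) hxD hxA

theorem facetIdeal_eq_partialFacetIdeal {A : Finset ι} (hA : A.Nonempty) :
    facetIdeal r A = partialFacetIdeal r A A := by
  have := Finset.card_pos.2 hA
  suffices hs : {C | C ⊆ A ∧ C.card + 1 = A.card} = faces A A (A.card - 1) by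
    rw [facetIdeal, hs]
  ext C
  simp only [faces, Set.mem_ofPred_eq]
  refine and_congr_right fun _ => ⟨fun h2 => ⟨fun h3 => ?_, by omega⟩, fun h2 => by omega⟩
  have := Finset.card_le_card h3
  omega

theorem IsPseudoRootRing.mul_mem_span_iff (h : IsPseudoRootRing r π) {X : Finset (Finset ι)}
    {A : Finset ι} (hA : A.Nonempty) (hAX : A ∉ X) (hX : ∀ C, C.card < A.card → C ∈ X)
    (hX' : ∀ C ∈ X, C.card ≤ A.card) (x : R) :
    x * r A ∈ Submodule.span R (r '' (X : Set (Finset ι))) ↔ x ∈ facetIdeal r A := by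
  constructor
  · intro hx
    obtain ⟨c, hc⟩ := (Submodule.mem_span_image_finset_iff_exists_fun' R).1 hx
    have := h.coeff_mem (b := Pi.single A x - fun C => if C ∈ X then c C else 0) hA
      (fun C hC => by
        have h1 : C ≠ A := by rintro rfl; omega
        have h2 : C ∉ X := fun h' => by have := hX' C h'; omega
        simp [Pi.single_eq_of_ne h1, h2])
      (by
        simp only [Pi.sub_apply, sub_mul, Finset.sum_sub_distrib]
        rw [sub_eq_zero]
        simpa [Pi.single_apply, ite_mul] using hc.symm)
    simpa [hAX] using this
  · intro hx
    obtain ⟨i, hi⟩ := hA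
    suffices hle : facetIdeal r A ≤ Submodule.comap
        (LinearMap.toSpanSingleton R R (r A)) (Submodule.span R (r '' (X : Set (Finset ι)))) from
      hle hx
    refine diffIdeal_le (D := A.erase i) fun C hC => ?_
    obtain ⟨j, hj, rfl⟩ := exists_erase_of_facet hC.1 hC.2
    change (r (A.erase j) - r (A.erase i)) * r A ∈ Submodule.span R (r '' (X : Set (Finset ι)))
    have hrel := h.rel _ A le_rfl j hj i hi
    simp only [smul_eq_mul] at hrel
    have hmem : ∀ i ∈ A, ∀ y, y * r (A.erase i) ∈
        Submodule.span R (r '' (X : Set (Finset ι))) := fun i hi y =>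
      Submodule.smul_mem _ y (Submodule.subset_span
        ⟨_, hX _ (Finset.card_erase_lt_of_mem hi), rfl⟩)
    have : (r (A.erase j) - r (A.erase i)) * r A =
        (r (A.erase j) - r ((A.erase j).erase i)) * r (A.erase j) -
        (r (A.erase i) - r ((A.erase j).erase i)) * r (A.erase i) := by
      rw [← sub_eq_zero] at hrel ⊢
      rw [← hrel]
      simp only [mul_sub, sub_mul]
      abel
    rw [this]
    exact sub_mem (hmem j hj _) (hmem i hi _)

end PseudoRoot

/-! ### Submodules with linear quotients -/

section LinearQuotients

variable {R : Type*} [Ring R]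

/-- A submodule has linear quotients if it can be built by successively adjoining generators from
`F₁` in such a way that each colon ideal belongs to `𝒥`. -/
inductive HasLinearQuotients {M : Type*} [AddCommGroup M] [Module R M] (𝒥 : Set (Ideal R))
    (F₁ : Set M) : Submodule R M → Prop
  | bot : HasLinearQuotients 𝒥 F₁ ⊥
  | sup_span (N : Submodule R M) (v : M) (J : Ideal R) : HasLinearQuotients 𝒥 F₁ N → v ∈ F₁ →
      J ∈ 𝒥 → (∀ x : R, x • v ∈ N ↔ x ∈ J) → HasLinearQuotients 𝒥 F₁ (N ⊔ Submodule.span R {v})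

theorem HasLinearQuotients.map {M M' : Type*} [AddCommGroup M] [Module R M] [AddCommGroup M']
    [Module R M'] {𝒥 : Set (Ideal R)} {F₁ : Set M} {F₁' : Set M'} {N : Submodule R M}
    (hN : HasLinearQuotients 𝒥 F₁ N) (f : M →ₗ[R] M') (hf : Function.Injective f)
    (hf₁ : ∀ v ∈ F₁, f v ∈ F₁') : HasLinearQuotients 𝒥 F₁' (N.map f) := by
  induction hN with
  | bot => rw [Submodule.map_bot]; exact .bot
  | sup_span N v J _ hv hJ hcolon ih =>
    rw [Submodule.map_sup, Submodule.map_span, Set.image_singleton]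
    refine .sup_span _ _ J ih (hf₁ v hv) hJ fun x => ?_
    rw [← hcolon, ← map_smul, Submodule.mem_map]
    exact ⟨fun ⟨y, hy, hyx⟩ => hf hyx ▸ hy, fun hx => ⟨_, hx, rfl⟩⟩

/-- An additive projection `P` onto a subgroup `R₁` of degree one elements, together with a
companion `Q` acting as the projection onto degree two. -/
structure IsLinearPart (R₁ : AddSubgroup R) (P Q : R →+ R) : Prop where
  proj_mem : ∀ x, P x ∈ R₁
  proj_eq : ∀ y ∈ R₁, P y = y
  proj_mul : ∀ x, ∀ y ∈ R₁, Q (x * y) = P x * y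

variable {R₁ : AddSubgroup R} {P Q : R →+ R} {𝒥 : Set (Ideal R)}

theorem IsLinearPart.exists_linear_combination (h : IsLinearPart R₁ P Q) {α β : Type*}
    {v : β → α →₀ R} (hv : ∀ b a, v b a ∈ R₁) {v₀ : α →₀ R} (hv₀ : ∀ a, v₀ a ∈ R₁) {j : R}
    (hj : j ∈ R₁) (hjv : j • v₀ ∈ Submodule.span R (Set.range v)) :
    ∃ c : β →₀ R, (∀ b, c b ∈ R₁) ∧ Finsupp.linearCombination R v c = j • v₀ := by
  obtain ⟨c, hc⟩ := (Finsupp.mem_span_range_iff_exists_finsupp).1 hjv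
  refine ⟨c.mapRange P (map_zero P), fun b => h.proj_mem _, ?_⟩
  ext a
  have := congrArg (fun y => Q (y a)) hc
  simp only [Finsupp.smul_apply, smul_eq_mul, h.proj_mul _ _ (hv₀ a), h.proj_eq j hj] at this
  rw [Finsupp.smul_apply, smul_eq_mul, ← this, Finsupp.linearCombination_apply,
    Finsupp.sum_mapRange_index (by simp), Finsupp.sum, Finsupp.sum, Finsupp.finsetSum_apply,
    Finsupp.finsetSum_apply, map_sum]
  exact Finset.sum_congr rfl fun b _ => (h.proj_mul _ _ (hv b a)).symm

/-- If all the colon ideals have linear quotients, a submodule of a free module with linear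
quotients has degree one generators whose module of relations has linear quotients. -/
theorem IsLinearPart.exists_generators (h : IsLinearPart R₁ P Q)
    (h𝒥 : ∀ J ∈ 𝒥, HasLinearQuotients 𝒥 (R₁ : Set R) J) {α : Type} {N : Submodule R (α →₀ R)}
    (hN : HasLinearQuotients 𝒥 {x | ∀ a, x a ∈ R₁} N) :
    ∃ (β : Type) (v : β → α →₀ R), (∀ b a, v b a ∈ R₁) ∧ Submodule.span R (Set.range v) = N ∧
      HasLinearQuotients 𝒥 {x | ∀ b, x b ∈ R₁} (LinearMap.ker (Finsupp.linearCombination R v)) := by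
  induction hN with
  | bot =>
    refine ⟨Empty, Empty.elim, fun b => b.elim, by simp, ?_⟩
    have : LinearMap.ker (Finsupp.linearCombination R (Empty.elim : Empty → α →₀ R)) = ⊥ :=
      Subsingleton.elim _ _
    rw [this]
    exact .bot
  | sup_span N v₀ J _ hv₀ hJ hcolon ih =>
    obtain ⟨β, v, hv, rfl, hker⟩ := ih
    set v' : Option β → α →₀ R := fun b => b.elim v₀ v with hv'
    set K : Submodule R (Option β →₀ R) := LinearMap.ker (Finsupp.linearCombination R v') with hK
    set e : (β →₀ R) →ₗ[R] (Option β →₀ R) := Finsupp.lmapDomain R R some with he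
    have heinj : Function.Injective e := Finsupp.mapDomain_injective (Option.some_injective β)
    have hesome : ∀ x b, e x (some b) = x b := fun x b =>
      Finsupp.mapDomain_apply (Option.some_injective β) x b
    have henone : ∀ x, e x none = 0 := fun x => Finsupp.mapDomain_of_notMem_range _ _ (by simp)
    have hve : ∀ x, Finsupp.linearCombination R v' (e x) = Finsupp.linearCombination R v x :=
      fun x => Finsupp.linearCombination_mapDomain ..
    refine ⟨Option β, v', ?_, ?_, ?_⟩
    · rintro (_ | b) a
      · exact hv₀ a
      · exact hv b a
    · have : Set.range v' = insert v₀ (Set.range v) := Option.range_eq v'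
      rw [this, sup_comm, Submodule.span_insert]
    have key : ∀ J', HasLinearQuotients 𝒥 (R₁ : Set R) J' → J' ≤ J →
        HasLinearQuotients 𝒥 {x | ∀ b, x b ∈ R₁}
          (K ⊓ Submodule.comap (Finsupp.lapply none) J') := by
      intro J' hJ'
      induction hJ' with
      | bot =>
        intro _
        have : K ⊓ Submodule.comap (Finsupp.lapply none) ⊥ =
            (LinearMap.ker (Finsupp.linearCombination R v)).map e := by
          ext x
          simp only [Submodule.mem_inf, Submodule.mem_comap, Submodule.mem_bot,
            Finsupp.lapply_apply, Submodule.mem_map, hK, LinearMap.mem_ker]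
          constructor
          · rintro ⟨hx, hx0⟩
            have hxe : e x.some = x := by
              ext (_ | b)
              · rw [henone, hx0]
              · rw [hesome, Finsupp.some_apply]
            exact ⟨x.some, by rw [← hve, hxe, hx], hxe⟩
          · rintro ⟨y, hy, rfl⟩
            exact ⟨by rw [hve, hy], henone y⟩
        rw [this]
        refine hker.map e heinj fun y hy b => ?_
        cases b with
        | none => rw [henone]; exact zero_mem _
        | some b => rw [hesome]; exact hy b
      | sup_span J' j L _ hj hL hcol ih =>
        intro hle
        have hjJ : j ∈ J := hle (Submodule.mem_sup_right (Submodule.mem_span_singleton_self j))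
        obtain ⟨c, hc₁, hc⟩ := h.exists_linear_combination hv hv₀ hj ((hcolon j).2 hjJ)
        set w : Option β →₀ R := Finsupp.single none j - e c with hw
        have hwnone : w none = j := by simp [hw, henone]
        have hwK : w ∈ K := by
          rw [hK, LinearMap.mem_ker, hw, map_sub, hve, hc, Finsupp.linearCombination_single]
          exact sub_self _
        have hsup : K ⊓ Submodule.comap (Finsupp.lapply none) (J' ⊔ Submodule.span R {j}) =
            (K ⊓ Submodule.comap (Finsupp.lapply none) J') ⊔ Submodule.span R {w} := by
          apply le_antisymm
          · rintro x ⟨hxK, hxJ⟩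
            obtain ⟨y, hy, z, hz, hyz⟩ := Submodule.mem_sup.1 hxJ
            obtain ⟨a, rfl⟩ := Submodule.mem_span_singleton.1 hz
            rw [Finsupp.lapply_apply] at hyz
            refine Submodule.mem_sup.2 ⟨x - a • w, ⟨sub_mem hxK (K.smul_mem a hwK), ?_⟩, a • w,
              Submodule.smul_mem _ _ (Submodule.mem_span_singleton_self w), sub_add_cancel _ _⟩
            change (x - a • w) none ∈ J'
            rw [Finsupp.sub_apply, Finsupp.smul_apply, hwnone, ← hyz, add_sub_cancel_right]
            exact hy
          · refine sup_le (inf_le_inf_left _ (Submodule.comap_mono le_sup_left)) ?_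
            rw [Submodule.span_singleton_le_iff_mem]
            refine ⟨hwK, ?_⟩
            rw [SetLike.mem_coe, Submodule.mem_comap, Finsupp.lapply_apply, hwnone]
            exact Submodule.mem_sup_right (Submodule.mem_span_singleton_self j)
        rw [hsup]
        refine .sup_span _ w L (ih (le_sup_left.trans hle)) ?_ hL fun x => ?_
        · rintro (_ | b)
          · rw [hwnone]; exact hj
          · have : w (some b) = -c b := by simp [hw, hesome]
            rw [this]
            exact neg_mem (hc₁ b)
        · rw [← hcol, Submodule.mem_inf, and_iff_right (K.smul_mem x hwK), Submodule.mem_comap,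
            Finsupp.lapply_apply, Finsupp.smul_apply, hwnone]
    have hall : K ⊓ Submodule.comap (Finsupp.lapply none) J = K := by
      refine inf_eq_left.2 fun x hx => ?_
      rw [Submodule.mem_comap, Finsupp.lapply_apply, ← hcolon]
      have hx' : x = Finsupp.single none (x none) + e x.some := by
        ext (_ | b)
        · simp [henone]
        · simp [hesome]
      rw [hK, LinearMap.mem_ker, hx', map_add, hve, Finsupp.linearCombination_single] at hx
      have hx'' : x none • v₀ + Finsupp.linearCombination R v x.some = 0 := hx
      rw [eq_neg_of_add_eq_zero_left hx'']
      exact neg_mem (Finsupp.mem_span_range_iff_exists_finsupp.2 ⟨x.some, rfl⟩)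
    rw [← hK, ← hall]
    exact key J (h𝒥 J hJ) le_rfl

/-- A submodule with linear quotients of some free module. -/
structure LinearSubmodule (R₁ : AddSubgroup R) (𝒥 : Set (Ideal R)) where
  /-- The basis of the ambient free module. -/
  basis : Type
  /-- The submodule itself. -/
  carrier : Submodule R (basis →₀ R)
  hasLinearQuotients : HasLinearQuotients 𝒥 {x | ∀ b, x b ∈ R₁} carrier

theorem IsLinearPart.exists_next (h : IsLinearPart R₁ P Q)
    (h𝒥 : ∀ J ∈ 𝒥, HasLinearQuotients 𝒥 (R₁ : Set R) J) (S : LinearSubmodule R₁ 𝒥) :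
    ∃ (T : LinearSubmodule R₁ 𝒥) (v : T.basis → S.basis →₀ R), (∀ b a, v b a ∈ R₁) ∧
      LinearMap.range (Finsupp.linearCombination R v) = S.carrier ∧
      LinearMap.ker (Finsupp.linearCombination R v) = T.carrier := by
  obtain ⟨β, v, hv, hrange, hker⟩ := h.exists_generators h𝒥 S.hasLinearQuotients
  exact ⟨⟨β, _, hker⟩, v, hv, by rw [Finsupp.range_linearCombination, hrange], rfl⟩

end LinearQuotients

/-! ### Linear quotients in pseudo-root rings -/

section PseudoRootQuotients

set_option linter.unusedSectionVars false

variable {ι : Type*} [DecidableEq ι] [Fintype ι] {R : Type*} [Ring R]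
  {r : Finset ι → R} {π : ℕ → R →+ R} {R₁ : AddSubgroup R}

/-- The ideals `partialFacetIdeal r A S` attached to nonempty subsets `S` of `A`. -/
def partialFacetIdeals (r : Finset ι → R) : Set (Ideal R) :=
  {J | ∃ A S : Finset ι, S.Nonempty ∧ S ⊆ A ∧ J = partialFacetIdeal r A S}

theorem exists_erase_of_mem_faces {A S C : Finset ι} (hS : S.Nonempty) (hSA : S ⊆ A)
    (hC : C ∈ faces A S (A.card - 1)) : ∃ u ∈ S, C = A.erase u := by
  have := Finset.card_pos.2 (hS.mono hSA)
  obtain ⟨u, -, rfl⟩ := exists_erase_of_facet hC.1 (by have := hC.2.2; omega)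
  exact ⟨u, by_contra fun hu => hC.2.1 (Finset.subset_erase.2 ⟨hSA, hu⟩), rfl⟩

theorem erase_mem_faces {A S : Finset ι} {u : ι} (hSA : S ⊆ A) (hu : u ∈ S) :
    A.erase u ∈ faces A S (A.card - 1) :=
  ⟨Finset.erase_subset _ _, fun h => Finset.notMem_erase u A (h hu),
    Finset.card_erase_of_mem (hSA hu)⟩

theorem IsPseudoRootRing.hasLinearQuotients_partialFacetIdeal (h : IsPseudoRootRing r π)
    (h₁ : ∀ A, r A ∈ R₁) {A S : Finset ι} (hS : S.Nonempty) (hSA : S ⊆ A) :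
    HasLinearQuotients (partialFacetIdeals r) (R₁ : Set R) (partialFacetIdeal r A S) := by
  induction hS using Finset.Nonempty.cons_induction with
  | singleton s =>
    have : partialFacetIdeal r A {s} = ⊥ := by
      refine le_bot_iff.1 (diffIdeal_le (D := A.erase s) fun C hC => ?_)
      obtain ⟨u, hu, rfl⟩ := exists_erase_of_mem_faces (Finset.singleton_nonempty s) hSA hC
      simp [Finset.mem_singleton.1 hu]
    rw [this]
    exact .bot
  | cons t S htS hS ih =>
    rw [Finset.cons_eq_insert, Finset.insert_subset_iff] at hSA
    obtain ⟨htA, hSA⟩ := hSA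
    have hSA' : insert t S ⊆ A := Finset.insert_subset htA hSA
    obtain ⟨s, hs⟩ := id hS
    have hmono : partialFacetIdeal r A S ≤ partialFacetIdeal r A (insert t S) :=
      diffIdeal_mono fun C hC => ⟨hC.1, fun h => hC.2.1 ((Finset.subset_insert _ _).trans h),
        hC.2.2⟩
    have hsup : partialFacetIdeal r A (insert t S) =
        partialFacetIdeal r A S ⊔ Submodule.span R {r (A.erase t) - r (A.erase s)} := by
      apply le_antisymm
      · refine diffIdeal_le (D := A.erase s) fun C hC => ?_
        obtain ⟨u, hu, rfl⟩ := exists_erase_of_mem_faces (Finset.insert_nonempty t S) hSA' hC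
        rcases Finset.mem_insert.1 hu with rfl | hu
        · exact Submodule.mem_sup_right (Submodule.mem_span_singleton_self _)
        · exact Submodule.mem_sup_left
            (sub_mem_diffIdeal (erase_mem_faces hSA hu) (erase_mem_faces hSA hs))
      · refine sup_le hmono ?_
        rw [Submodule.span_singleton_le_iff_mem]
        exact sub_mem_diffIdeal (erase_mem_faces hSA' (Finset.mem_insert_self t S))
          (erase_mem_faces hSA' (Finset.mem_insert_of_mem hs))
    rw [Finset.cons_eq_insert, hsup]
    exact .sup_span _ _ (partialFacetIdeal r (A.erase t) S) (ih hSA) (sub_mem (h₁ _) (h₁ _))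
      ⟨_, S, hS, Finset.subset_erase.2 ⟨hSA, htS⟩, rfl⟩ fun x =>
        ⟨h.mem_partialFacetIdeal_of_mul_mem hSA htA htS hs,
          h.mul_mem_partialFacetIdeal hSA htA htS hs⟩

theorem IsPseudoRootRing.hasLinearQuotients_span (h : IsPseudoRootRing r π)
    (h₁ : ∀ A, r A ∈ R₁) (X : Finset (Finset ι))
    (hX : ∀ C ∈ X, ∀ D : Finset ι, D.card < C.card → D ∈ X) :
    HasLinearQuotients (partialFacetIdeals r) (R₁ : Set R)
      (Submodule.span R (r '' (X : Set (Finset ι)))) := by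
  induction X using Finset.strongInduction with
  | H X ih =>
    rcases X.eq_empty_or_nonempty with rfl | hne
    · simpa using HasLinearQuotients.bot
    · obtain ⟨A, hA, hmax⟩ := X.exists_max_image Finset.card hne
      have ih' := ih (X.erase A) (Finset.erase_ssubset hA) fun C hC D hD => by
        have hCX := Finset.mem_of_mem_erase hC
        refine Finset.mem_erase.2 ⟨?_, hX C hCX D hD⟩
        rintro rfl
        have := hmax C hCX
        omega
      have hspan : Submodule.span R (r '' (X : Set (Finset ι))) =
          Submodule.span R (r '' ((X.erase A : Finset _) : Set (Finset ι))) ⊔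
            Submodule.span R {r A} := by
        rw [← Submodule.span_union, ← Set.image_singleton, ← Set.image_union,
          ← Finset.coe_singleton, ← Finset.coe_union, Finset.union_comm, ← Finset.insert_eq,
          Finset.insert_erase hA]
      rw [hspan]
      rcases A.eq_empty_or_nonempty with rfl | hAne
      · simpa [h.empty] using ih'
      · refine .sup_span _ _ (partialFacetIdeal r A A) ih' (h₁ A) ⟨A, A, hAne, subset_rfl, rfl⟩
          fun x => ?_
        rw [smul_eq_mul, ← facetIdeal_eq_partialFacetIdeal hAne]
        refine h.mul_mem_span_iff hAne (Finset.notMem_erase A X) (fun C hC => ?_)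
          (fun C hC => hmax C (Finset.mem_of_mem_erase hC)) x
        exact Finset.mem_erase.2 ⟨by rintro rfl; omega, hX A hA C hC⟩

end PseudoRootQuotients

/-! ### The algebra `Q_n` -/

section Concrete

variable (k : Type) [Field k] (n : ℕ)

theorem FreeADeg_mul_mem {a b : FreeA k n} {d e : ℕ} (ha : a ∈ FreeADeg k n d)
    (hb : b ∈ FreeADeg k n e) : a * b ∈ FreeADeg k n (d + e) := by
  have := Submodule.mul_mem_mul ha hb
  rw [FreeADeg, FreeADeg, Submodule.span_mul_span] at this
  refine Submodule.span_mono ?_ this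
  rintro _ ⟨_, ⟨l, rfl, rfl⟩, _, ⟨l', rfl, rfl⟩, rfl⟩
  exact ⟨l ++ l', by simp, by simp⟩

theorem one_mem_FreeADeg : (1 : FreeA k n) ∈ FreeADeg k n 0 :=
  Submodule.subset_span ⟨[], rfl, rfl⟩

theorem ι_mem_FreeADeg (A : SubsetIdx n) : FreeAlgebra.ι k A ∈ FreeADeg k n 1 :=
  Submodule.subset_span ⟨[A], rfl, by simp⟩

theorem rGen_mem_FreeADeg (A : Finset (Fin n)) : rGen k n A ∈ FreeADeg k n 1 := by
  rw [rGen]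
  split_ifs with h
  · exact ι_mem_FreeADeg k n _
  · exact zero_mem _

theorem QnDeg_mul_mem {a b : Qn k n} {d e : ℕ} (ha : a ∈ QnDeg k n d) (hb : b ∈ QnDeg k n e) :
    a * b ∈ QnDeg k n (d + e) := by
  obtain ⟨a, ha, rfl⟩ := ha
  obtain ⟨b, hb, rfl⟩ := hb
  exact ⟨a * b, FreeADeg_mul_mem k n ha hb, map_mul (QnMk k n) a b⟩

theorem QnMk_surjective : Function.Surjective (QnMk k n) :=
  RingQuot.mkAlgHom_surjective k (QnRel k n)

theorem iSup_FreeADeg : ⨆ d, FreeADeg k n d = ⊤ := by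
  rw [eq_top_iff, ← Algebra.top_toSubmodule, ← FreeAlgebra.adjoin_range_ι, Algebra.adjoin_eq_span,
    Submodule.span_le]
  intro x hx
  suffices h : ∃ d, x ∈ FreeADeg k n d from
    let ⟨d, hd⟩ := h
    Submodule.mem_iSup_of_mem d hd
  induction hx using Submonoid.closure_induction with
  | mem x hx =>
    obtain ⟨A, rfl⟩ := hx
    exact ⟨1, ι_mem_FreeADeg k n A⟩
  | one => exact ⟨0, one_mem_FreeADeg k n⟩
  | mul x y _ _ hx hy =>
    obtain ⟨d, hd⟩ := hx
    obtain ⟨e, he⟩ := hy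
    exact ⟨d + e, FreeADeg_mul_mem k n hd he⟩

variable {k n} in
theorem Qn_homogeneous_induction {p : Qn k n → Prop} (hom : ∀ d, ∀ x ∈ QnDeg k n d, p x)
    (zero : p 0) (add : ∀ x y, p x → p y → p (x + y)) (x : Qn k n) : p x := by
  have htop : ⨆ d, QnDeg k n d = ⊤ := by
    simp only [QnDeg]
    rw [← Submodule.map_iSup, iSup_FreeADeg, Submodule.map_top]
    exact LinearMap.range_eq_top.2 (QnMk_surjective k n)
  exact Submodule.iSup_induction _ (motive := p) (htop ▸ Submodule.mem_top : x ∈ ⨆ d, QnDeg k n d)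
    hom zero add

theorem QnMk_fRel {A : Finset (Fin n)} {i j : Fin n} (hi : i ∈ A) (hj : j ∈ A) :
    QnMk k n (fRel k n A i j) = 0 := by
  rw [QnMk, RingQuot.mkAlgHom_rel k (QnRel.rel A i j hi hj), map_zero]

open Polynomial in
/-- The homomorphism on the free algebra multiplying each generator by a central variable. -/
def freeGrading : FreeA k n →ₐ[k] (Qn k n)[X] :=
  FreeAlgebra.lift k fun A => C (QnMk k n (FreeAlgebra.ι k A)) * X

open Polynomial in
theorem freeGrading_of_mem {d : ℕ} {x : FreeA k n} (hx : x ∈ FreeADeg k n d) :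
    freeGrading k n x = C (QnMk k n x) * X ^ d := by
  induction hx using Submodule.span_induction with
  | zero => simp
  | add x y _ _ hx hy => rw [map_add, hx, hy, map_add, C_add, add_mul]
  | smul c x _ hx => rw [map_smul, hx, map_smul, ← smul_C, smul_mul_assoc]
  | mem x hx =>
    obtain ⟨l, rfl, rfl⟩ := hx
    induction l with
    | nil => simp
    | cons A l ih =>
      rw [List.map_cons, List.prod_cons, map_mul, ih, map_mul, C_mul, List.length_cons, pow_succ',
        freeGrading, FreeAlgebra.lift_ι_apply, mul_assoc, ← mul_assoc X, X_mul_C]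
      simp only [mul_assoc]

open Polynomial in
/-- The homomorphism `Q_n → Q_n[X]` sending `x` of degree `d` to `x X^d`. -/
def gradingHom : Qn k n →ₐ[k] (Qn k n)[X] :=
  RingQuot.liftAlgHom k ⟨freeGrading k n, by
    rintro _ _ ⟨A, i, j, hi, hj⟩
    have h2 : fRel k n A i j ∈ FreeADeg k n (1 + 1) := by
      have hg := rGen_mem_FreeADeg k n
      rw [fRel, pow_two, pow_two]
      exact add_mem (sub_mem (add_mem (FreeADeg_mul_mem k n (hg _) (sub_mem (hg _) (hg _)))
        (FreeADeg_mul_mem k n (sub_mem (hg _) (hg _)) (hg _))) (FreeADeg_mul_mem k n (hg _) (hg _)))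
        (FreeADeg_mul_mem k n (hg _) (hg _))
    rw [freeGrading_of_mem k n h2, QnMk_fRel k n hi hj, map_zero, map_zero, zero_mul]⟩

open Polynomial in
theorem gradingHom_of_mem {d : ℕ} {x : Qn k n} (hx : x ∈ QnDeg k n d) :
    gradingHom k n x = C x * X ^ d := by
  obtain ⟨x, hx, rfl⟩ := hx
  refine Eq.trans ?_ (freeGrading_of_mem k n hx)
  exact RingQuot.liftAlgHom_mkAlgHom_apply ..

theorem coeff_gradingHom_of_mem {d : ℕ} {x : Qn k n} (hx : x ∈ QnDeg k n d) (e : ℕ) :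
    (gradingHom k n x).coeff e = if e = d then x else 0 := by
  rw [gradingHom_of_mem k n hx, Polynomial.coeff_C_mul_X_pow]

/-- The projection of `Q_nᵐᵒᵖ` onto its component of degree `d`. -/
def degProj (d : ℕ) : QnOp k n →+ QnOp k n where
  toFun x := op ((gradingHom k n (unop x)).coeff d)
  map_zero' := by simp
  map_add' x y := by simp

theorem coeff_gradingHom_mem (x : Qn k n) (d : ℕ) :
    (gradingHom k n x).coeff d ∈ QnDeg k n d := by
  induction x using Qn_homogeneous_induction with
  | hom e x hx =>
    rw [coeff_gradingHom_of_mem k n hx]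
    split_ifs with h
    · exact h ▸ hx
    · exact zero_mem _
  | zero => simp
  | add x y hx hy => rw [map_add, Polynomial.coeff_add]; exact add_mem hx hy

theorem mem_QnOpDeg {d : ℕ} {x : QnOp k n} : x ∈ QnOpDeg k n d ↔ unop x ∈ QnDeg k n d := by
  rw [QnOpDeg, Submodule.mem_map]
  exact ⟨by rintro ⟨y, hy, rfl⟩; exact hy, fun h => ⟨unop x, h, rfl⟩⟩

theorem degProj_mem (d : ℕ) (x : QnOp k n) : degProj k n d x ∈ QnOpDeg k n d :=
  (mem_QnOpDeg k n).2 (coeff_gradingHom_mem k n (unop x) d)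

theorem degProj_of_mem {d : ℕ} {x : QnOp k n} (hx : x ∈ QnOpDeg k n d) : degProj k n d x = x := by
  change op _ = _
  rw [coeff_gradingHom_of_mem k n ((mem_QnOpDeg k n).1 hx), if_pos rfl, op_unop]

theorem degProj_zero_mul {y : QnOp k n} (hy : y ∈ QnOpDeg k n 1) (x : QnOp k n) :
    degProj k n 0 (x * y) = 0 := by
  change op _ = _
  rw [unop_mul, map_mul, gradingHom_of_mem k n ((mem_QnOpDeg k n).1 hy), pow_one, mul_assoc,
    Polynomial.coeff_C_mul, Polynomial.coeff_X_mul_zero, mul_zero, op_zero]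

theorem degProj_succ_mul {y : QnOp k n} (hy : y ∈ QnOpDeg k n 1) (d : ℕ) (x : QnOp k n) :
    degProj k n (d + 1) (x * y) = degProj k n d x * y := by
  change op _ = op _ * _
  rw [unop_mul, map_mul, gradingHom_of_mem k n ((mem_QnOpDeg k n).1 hy), pow_one, mul_assoc,
    Polynomial.coeff_C_mul, Polynomial.coeff_X_mul, op_mul, op_unop]

theorem exists_sum_degProj (x : QnOp k n) :
    ∃ N, ∀ M ≥ N, ∑ d ∈ Finset.range M, degProj k n d x = x := by
  suffices h : ∀ x : Qn k n, ∃ N, ∀ M ≥ N, ∑ d ∈ Finset.range M, degProj k n d (op x) = op x from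
    h (unop x)
  intro x
  induction x using Qn_homogeneous_induction with
  | hom e x hx =>
    refine ⟨e + 1, fun M hM => ?_⟩
    rw [Finset.sum_eq_single e]
    · exact degProj_of_mem k n ((mem_QnOpDeg k n).2 hx)
    · intro d _ hd
      change op _ = _
      rw [unop_op, coeff_gradingHom_of_mem k n hx, if_neg hd, op_zero]
    · intro he
      exact absurd (Finset.mem_range.2 (by omega)) he
  | zero => exact ⟨0, fun M _ => by simp⟩
  | add x y hx hy =>
    obtain ⟨N, hN⟩ := hx
    obtain ⟨N', hN'⟩ := hy
    refine ⟨max N N', fun M hM => ?_⟩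
    simp only [op_add, map_add, Finset.sum_add_distrib]
    rw [hN M (le_of_max_le_left hM), hN' M (le_of_max_le_right hM)]

/-- The generator `r_A` as an element of the opposite algebra. -/
def rOp (A : Finset (Fin n)) : QnOp k n := op (QnMk k n (rGen k n A))

theorem rOp_mem (A : Finset (Fin n)) : rOp k n A ∈ QnOpDeg k n 1 :=
  (mem_QnOpDeg k n).2 ⟨_, rGen_mem_FreeADeg k n A, rfl⟩

theorem rOp_empty : rOp k n ∅ = 0 := by simp [rOp, rGen]

theorem rOp_rel {A : Finset (Fin n)} {i j : Fin n} (hi : i ∈ A) (hj : j ∈ A) :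
    (rOp k n (A.erase i) - rOp k n (A.erase j)) * rOp k n A +
      rOp k n ((A.erase i).erase j) * (rOp k n (A.erase i) - rOp k n (A.erase j)) -
      rOp k n (A.erase i) * rOp k n (A.erase i) +
      rOp k n (A.erase j) * rOp k n (A.erase j) = 0 := by
  have := congrArg op (QnMk_fRel k n hi hj)
  simpa [fRel, pow_two, rOp] using this

theorem pseudoRel_rOp (p : ℕ) : PseudoRel (rOp k n) (rOp k n) p := by
  intro C _ i hi j hj
  rw [← sub_eq_zero, ← rOp_rel k n hi hj]
  simp only [smul_eq_mul, mul_sub, sub_mul]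
  abel


section Extension

variable {M : Type*} [AddCommGroup M] [Module (QnOp k n) M] [Module k M]
  [IsScalarTower k (QnOp k n) M] (e : Finset (Fin n) → M)

/-- The action of `r_A` on the extension of `k` by `M` determined by `e`. -/
def extAction (A : Finset (Fin n)) : Module.End k (k × M) where
  toFun x := (0, rOp k n A • x.2 + x.1 • e A)
  map_add' x y := by
    ext1
    · simp
    · simp only [Prod.snd_add, Prod.fst_add, smul_add, add_smul]
      abel
  map_smul' c x := by
    ext1
    · simp
    · simp only [Prod.smul_snd, Prod.smul_fst, smul_add, RingHom.id_apply, smul_eq_mul, mul_smul]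
      rw [smul_comm]

theorem extAction_apply (A : Finset (Fin n)) (x : k × M) :
    extAction k n e A x = (0, rOp k n A • x.2 + x.1 • e A) := rfl

theorem extAction_empty (he : e ∅ = 0) : extAction k n e ∅ = 0 :=
  LinearMap.ext fun x => by simp [extAction_apply, rOp_empty, he]

/-- The action of the free algebra generated by `extAction`. -/
def freeExtHom : FreeA k n →ₐ[k] (Module.End k (k × M))ᵐᵒᵖ :=
  FreeAlgebra.lift k fun A => op (extAction k n e A.1)

theorem freeExtHom_rGen (he : e ∅ = 0) (A : Finset (Fin n)) :
    freeExtHom k n e (rGen k n A) = op (extAction k n e A) := by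
  rw [rGen]
  split_ifs with h
  · simp [freeExtHom]
  · rw [Finset.not_nonempty_iff_eq_empty.1 h, extAction_empty k n e he, map_zero, op_zero]

variable {e}

theorem freeExtHom_fRel (he : e ∅ = 0) {A : Finset (Fin n)} {i j : Fin n} (hi : i ∈ A)
    (hj : j ∈ A)
    (hrel : (rOp k n (A.erase i) - rOp k n (A.erase j)) • e A +
      rOp k n ((A.erase i).erase j) • (e (A.erase i) - e (A.erase j)) -
      rOp k n (A.erase i) • e (A.erase i) + rOp k n (A.erase j) • e (A.erase j) = 0) :
    freeExtHom k n e (fRel k n A i j) = 0 := by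
  apply unop_injective
  simp only [fRel, pow_two, map_add, map_sub, map_mul, freeExtHom_rGen k n e he, unop_add,
    unop_sub, unop_mul, unop_op, unop_zero]
  refine LinearMap.ext fun x => ?_
  simp only [LinearMap.add_apply, LinearMap.sub_apply, Module.End.mul_apply, extAction_apply,
    LinearMap.zero_apply]
  ext1
  · simp
  · have h1 := congrArg (fun y => y • x.2) (rOp_rel k n hi hj)
    have h2 := congrArg (fun y => x.1 • y) hrel
    simp only [zero_smul, smul_zero] at h1 h2
    have h3 := congrArg₂ (· + ·) h1 h2
    simp only [add_zero] at h3
    simp only [Prod.snd_add, Prod.snd_sub, Prod.fst_sub, Prod.snd_zero, sub_self, zero_smul,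
      add_zero]
    rw [← h3]
    simp only [smul_add, smul_sub, sub_smul, add_smul, mul_smul, mul_sub, sub_mul,
      smul_comm x.1]
    abel

theorem freeExtHom_apply_inr (he : e ∅ = 0) (x : FreeA k n) (m : M) :
    (freeExtHom k n e x).unop (0, m) = (0, op (QnMk k n x) • m) := by
  induction x using FreeAlgebra.induction generalizing m with
  | grade0 c =>
    rw [AlgHom.commutes, AlgHom.commutes, MulOpposite.algebraMap_apply, unop_op,
      ← MulOpposite.algebraMap_apply, algebraMap_smul, Module.algebraMap_end_apply]
    simp
  | grade1 A =>
    have hA : FreeAlgebra.ι k A = rGen k n A.1 := by rw [rGen, dif_pos A.2]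
    rw [hA, freeExtHom_rGen k n e he, unop_op, extAction_apply]
    simp [rOp]
  | mul x y hx hy =>
    rw [map_mul, map_mul, unop_mul, Module.End.mul_apply, hx, hy, op_mul, mul_smul]
  | add x y hx hy =>
    rw [map_add, map_add, unop_add, LinearMap.add_apply, hx, hy, op_add, add_smul]
    simp

theorem sum_smul_eq_zero_of_sum_mul_rOp_eq_zero (he : e ∅ = 0)
    (hrel : ∀ A : Finset (Fin n), ∀ i ∈ A, ∀ j ∈ A,
      (rOp k n (A.erase i) - rOp k n (A.erase j)) • e A +
        rOp k n ((A.erase i).erase j) • (e (A.erase i) - e (A.erase j)) -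
        rOp k n (A.erase i) • e (A.erase i) + rOp k n (A.erase j) • e (A.erase j) = 0)
    {b : Finset (Fin n) → QnOp k n} (hb : ∑ A, b A * rOp k n A = 0) :
    ∑ A, b A • e A = 0 := by
  let θ : Qn k n →ₐ[k] (Module.End k (k × M))ᵐᵒᵖ := RingQuot.liftAlgHom k ⟨freeExtHom k n e, by
    rintro _ _ ⟨A, i, j, hi, hj⟩
    rw [freeExtHom_fRel k n he hi hj (hrel A i hi j hj), map_zero]⟩
  have hθ : ∀ x, θ (QnMk k n x) = freeExtHom k n e x := fun x =>
    RingQuot.liftAlgHom_mkAlgHom_apply ..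
  have key : ∀ A, (θ (unop (b A * rOp k n A))).unop (1, 0) = (0, b A • e A) := by
    intro A
    obtain ⟨x, hx⟩ := QnMk_surjective k n (unop (b A))
    rw [unop_mul, map_mul, unop_mul, Module.End.mul_apply, rOp, unop_op, hθ,
      freeExtHom_rGen k n e he, unop_op, extAction_apply]
    simp only [smul_zero, zero_add, one_smul]
    rw [← hx, hθ, freeExtHom_apply_inr k n he, hx, op_unop]
  have h1 := congrArg (fun x => ((θ (unop x)).unop (1, 0)).2) hb
  simpa only [unop_sum, map_sum, LinearMap.sum_apply, Prod.snd_sum, key, unop_zero,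
    map_zero, LinearMap.zero_apply, Prod.snd_zero] using h1

end Extension

theorem mem_relSpan_rOp {b : Finset (Fin n) → QnOp k n} (hb : b ∅ = 0)
    (hbr : ∑ A, b A * rOp k n A = 0) : b ∈ relSpan (rOp k n) n := by
  set π := (relSpan (rOp k n) n).mkQ with hπ
  let e : Finset (Fin n) → (Finset (Fin n) → QnOp k n) ⧸ relSpan (rOp k n) n :=
    fun A => if A.Nonempty then π (Pi.single A 1) else 0
  have he : ∀ A, A.Nonempty → e A = π (Pi.single A 1) := fun A hA => if_pos hA
  have hrel : ∀ A : Finset (Fin n), ∀ i ∈ A, ∀ j ∈ A,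
      (rOp k n (A.erase i) - rOp k n (A.erase j)) • e A +
        rOp k n ((A.erase i).erase j) • (e (A.erase i) - e (A.erase j)) -
        rOp k n (A.erase i) • e (A.erase i) + rOp k n (A.erase j) • e (A.erase j) = 0 := by
    intro A i hi j hj
    by_cases hij : i = j
    · subst hij; simp
    rw [he A ⟨i, hi⟩, he (A.erase i) ⟨j, Finset.mem_erase.2 ⟨Ne.symm hij, hj⟩⟩,
      he (A.erase j) ⟨i, Finset.mem_erase.2 ⟨hij, hi⟩⟩]
    have := pseudoRel_mkQ_relSpan (rOp k n) n A (by simpa using Finset.card_le_univ A) i hi j hj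
    rw [← sub_eq_zero] at this
    rw [← this]
    simp only [smul_sub, sub_smul]
    abel
  have h0 := sum_smul_eq_zero_of_sum_mul_rOp_eq_zero k n (e := e) (if_neg (by simp)) hrel hbr
  rw [← Submodule.Quotient.mk_eq_zero, ← Submodule.mkQ_apply, ← h0]
  conv_lhs => rw [pi_eq_sum_univ b, map_sum]
  refine Finset.sum_congr rfl fun A _ => ?_
  rw [map_smul]
  rcases A.eq_empty_or_nonempty with rfl | hA
  · rw [hb, zero_smul, zero_smul]
  · rw [he A hA]
    congr 2
    ext B
    simp [Pi.single_apply, eq_comm]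

theorem isPseudoRootRing_rOp : IsPseudoRootRing (rOp k n) (degProj k n) where
  rel := pseudoRel_rOp k n
  pres b hb hbr := by
    rw [Fintype.card_fin]
    exact mem_relSpan_rOp k n hb hbr
  empty := rOp_empty k n
  proj_zero x A := degProj_zero_mul k n (rOp_mem k n A) x
  proj_succ d x A := degProj_succ_mul k n (rOp_mem k n A) d x
  proj_proj d x := degProj_of_mem k n (degProj_mem k n d x)
  sum_proj := exists_sum_degProj k n

theorem isLinearPart_degProj :
    IsLinearPart (QnOpDeg k n 1).toAddSubgroup (degProj k n 1) (degProj k n 2) where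
  proj_mem x := degProj_mem k n 1 x
  proj_eq _ hy := degProj_of_mem k n hy
  proj_mul x _ hy := degProj_succ_mul k n hy 1 x

theorem QnOpDeg_succ_mem_span (d : ℕ) {x : QnOp k n} (hx : x ∈ QnOpDeg k n (d + 1)) :
    x ∈ Submodule.span (QnOp k n)
      (rOp k n '' ((Finset.univ : Finset (Finset (Fin n))) : Set (Finset (Fin n)))) := by
  obtain ⟨_, ⟨x, hx, rfl⟩, rfl⟩ := hx
  induction hx using Submodule.span_induction with
  | zero => simp
  | add x y _ _ hx hy => rw [map_add, map_add]; exact add_mem hx hy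
  | smul c x _ hx =>
    rw [map_smul, map_smul, ← algebraMap_smul (QnOp k n) c]
    exact Submodule.smul_mem _ _ hx
  | mem x hx =>
    obtain ⟨_ | ⟨A, l⟩, hl, rfl⟩ := hx
    · simp at hl
    · have hA : FreeAlgebra.ι k A = rGen k n A.1 := by rw [rGen, dif_pos A.2]
      rw [List.map_cons, List.prod_cons, hA]
      change op (QnMk k n (_ * _)) ∈ _
      rw [map_mul, op_mul]
      exact Submodule.smul_mem _ _ (Submodule.subset_span ⟨A.1, by simp, rfl⟩)

theorem augIdealQ_eq_span : augIdealQ k n = Submodule.span (QnOp k n)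
    (rOp k n '' ((Finset.univ : Finset (Finset (Fin n))) : Set (Finset (Fin n)))) := by
  apply le_antisymm
  · refine Submodule.span_le.2 ?_
    rintro x ⟨d, hd, hx⟩
    obtain ⟨d, rfl⟩ := Nat.exists_eq_add_of_le' hd
    exact QnOpDeg_succ_mem_span k n d hx
  · refine Submodule.span_le.2 ?_
    rintro _ ⟨A, -, rfl⟩
    exact Submodule.subset_span ⟨1, le_rfl, rOp_mem k n A⟩

/-- The augmentation from the free module of rank one. -/
def augMap : (Unit →₀ QnOp k n) →ₗ[QnOp k n] TrivQ k n :=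
  (augIdealQ k n).mkQ ∘ₗ Finsupp.lapply ()

theorem ker_augMap : LinearMap.ker (augMap k n) =
    Submodule.map (Finsupp.lsingle (R := QnOp k n) ()) (augIdealQ k n) := by
  ext x
  rw [augMap, LinearMap.ker_comp, Submodule.ker_mkQ, Submodule.mem_comap, Submodule.mem_map]
  constructor
  · intro hx
    exact ⟨x (), hx, by ext; simp⟩
  · rintro ⟨y, hy, rfl⟩
    simpa using hy

theorem hasLinearQuotients_ker_augMap :
    HasLinearQuotients (M := Unit →₀ QnOp k n) (partialFacetIdeals (rOp k n))
      {x | ∀ b, x b ∈ (QnOpDeg k n 1).toAddSubgroup} (LinearMap.ker (augMap k n)) := by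
  rw [ker_augMap, augIdealQ_eq_span]
  refine ((isPseudoRootRing_rOp k n).hasLinearQuotients_span
    (R₁ := (QnOpDeg k n 1).toAddSubgroup) (rOp_mem k n) Finset.univ (by simp)).map _
    (Finsupp.single_injective ()) fun v hv b => ?_
  simpa using hv

theorem mul_mem_shiftDegQ {i m : ℕ} {x y : QnOp k n} (hx : x ∈ shiftDegQ k n (i + 1) m)
    (hy : y ∈ QnOpDeg k n 1) : x * y ∈ shiftDegQ k n i m := by
  rw [shiftDegQ] at hx
  split_ifs at hx with hi
  · rw [shiftDegQ, if_pos (by omega), show m - i = 1 + (m - (i + 1)) by omega, mem_QnOpDeg,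
      unop_mul]
    exact QnDeg_mul_mem k n ((mem_QnOpDeg k n).1 hy) ((mem_QnOpDeg k n).1 hx)
  · rw [(Submodule.mem_bot k).1 hx, zero_mul]
    exact zero_mem _

end Concrete

/-- `Q_n` is Koszul. -/
theorem Qn_is_Koszul (k : Type) [Field k] (n : ℕ) (hn : 2 ≤ n) :
    ∃ (β : ℕ → Type)
      (d : ∀ i : ℕ, ((β (i + 1) →₀ QnOp k n) →ₗ[QnOp k n] (β i →₀ QnOp k n)))
      (ε : (β 0 →₀ QnOp k n) →ₗ[QnOp k n] TrivQ k n),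
      -- the resolution is exact: `⋯ → P_1 → P_0 → k → 0`
      Function.Surjective ε ∧
      LinearMap.ker ε = LinearMap.range (d 0) ∧
      (∀ i : ℕ, LinearMap.ker (d i) = LinearMap.range (d (i + 1))) ∧
      -- all differentials preserve degrees (the free generators of `P_i` having degree `i`)
      (∀ (i m : ℕ) (x : β (i + 1) →₀ QnOp k n),
        (∀ b, x b ∈ shiftDegQ k n (i + 1) m) → ∀ b, (d i x) b ∈ shiftDegQ k n i m) ∧
      -- the augmentation preserves degrees (`k` is concentrated in degree `0`)
      (∀ m : ℕ, 1 ≤ m → ∀ x : β 0 →₀ QnOp k n,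
        (∀ b, x b ∈ shiftDegQ k n 0 m) → ε x = 0) := by
  have h𝒥 : ∀ J ∈ partialFacetIdeals (rOp k n), HasLinearQuotients (partialFacetIdeals (rOp k n))
      ((QnOpDeg k n 1).toAddSubgroup : Set (QnOp k n)) J := by
    rintro _ ⟨A, S, hS, hSA, rfl⟩
    exact (isPseudoRootRing_rOp k n).hasLinearQuotients_partialFacetIdeal (rOp_mem k n) hS hSA
  choose next v hv hrange hker using (isLinearPart_degProj k n).exists_next h𝒥
  let S : ℕ → LinearSubmodule (QnOpDeg k n 1).toAddSubgroup (partialFacetIdeals (rOp k n)) :=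
    fun i => Nat.rec ⟨Unit, _, hasLinearQuotients_ker_augMap k n⟩ (fun _ T => next T) i
  refine ⟨fun i => (S i).basis, fun i => Finsupp.linearCombination _ (v (S i)), augMap k n,
    ?_, ?_, ?_, ?_, ?_⟩
  · intro x
    obtain ⟨y, rfl⟩ := (augIdealQ k n).mkQ_surjective x
    exact ⟨Finsupp.single () y, by simp [augMap]⟩
  · exact (hrange (S 0)).symm
  · intro i
    exact (hker (S i)).trans (hrange (S (i + 1))).symm
  · intro i m x hx b
    rw [Finsupp.linearCombination_apply, Finsupp.sum, Finsupp.finsetSum_apply]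
    exact Submodule.sum_mem _ fun c _ => mul_mem_shiftDegQ k n (hx c) (hv _ c b)
  · intro m hm x hx
    have hx' := hx ()
    rw [shiftDegQ, if_pos (Nat.zero_le m)] at hx'
    exact (Submodule.Quotient.mk_eq_zero _).2 (Submodule.subset_span ⟨m, hm, hx'⟩)
end
end

section
/- For every field k and every integer n ≥ 2, every element g^t_{A,B} (for any nonempty A ⊆ I_n with minimal element a_1, any t ≥ 0 and any B ⊆ A with |B| = t+1 and a_1 ∉ B) lies in the two-sided ideal I of the free algebra F generated by the relations h_{A;i,j}. -/
/-!
STATEMENT 3: For every field `k` and every integer `n ≥ 2`, every element `g^t_{A,B}`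
(for any nonempty `A ⊆ I_n` with minimal element `a_1`, any `t ≥ 0` and any `B ⊆ A` with
`|B| = t+1` and `a_1 ∉ B`) lies in the two-sided ideal `I` of the free algebra `F`
generated by the relations `h_{A;i,j}`.
-/

noncomputable section

open Finset

/-- The quadratic relation `h_{A;i,j} = r_A (r_{A∖i} - r_{A∖j})`. -/
def hRel (k : Type) [Field k] (n : ℕ) (A : Finset (Fin n)) (i j : Fin n) : FreeA k n :=
  rGen k n A * (rGen k n (A.erase i) - rGen k n (A.erase j))

/-- The two-sided ideal `I ⊆ F` generated by the relations `h_{A;i,j}` for `i, j ∈ A`. -/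
def hIdeal (k : Type) [Field k] (n : ℕ) : TwoSidedIdeal (FreeA k n) :=
  TwoSidedIdeal.span
    {x | ∃ A : Finset (Fin n), ∃ i ∈ A, ∃ j ∈ A, x = hRel k n A i j}

/-- `A` with its minimal element removed (`∅` if `A = ∅`). -/
def eraseMin {n : ℕ} (A : Finset (Fin n)) : Finset (Fin n) :=
  if h : A.Nonempty then A.erase (A.min' h) else ∅

/-- The monomial `S_A^t = r_A · r_{A∖{a_1}} · r_{A∖{a_1,a_2}} ⋯ r_{A∖{a_1,…,a_t}}`,
a product of `t+1` generators. -/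
def SMon (k : Type) [Field k] (n : ℕ) : ℕ → Finset (Fin n) → FreeA k n
  | 0, A => rGen k n A
  | (t+1), A => rGen k n A * SMon k n t (eraseMin A)

/-- The element `g^t_{A,B} = S_A^t · r_{A∖B} − S_A^{t+1}` of the free algebra. -/
def gElt (k : Type) [Field k] (n : ℕ) (t : ℕ) (A B : Finset (Fin n)) : FreeA k n :=
  SMon k n t A * rGen k n (A \ B) - SMon k n (t+1) A

theorem eraseMin_eq_erase {n : ℕ} {A : Finset (Fin n)} (h : A.Nonempty) :
    eraseMin A = A.erase (A.min' h) := dif_pos h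

/-- Erasing an element other than the minimum commutes with erasing the minimum. -/
theorem eraseMin_erase {n : ℕ} {A : Finset (Fin n)} (hA : A.Nonempty) {b : Fin n}
    (hb : b ≠ A.min' hA) : eraseMin (A.erase b) = (eraseMin A).erase b := by
  have hmem : A.min' hA ∈ A.erase b := mem_erase.2 ⟨hb.symm, A.min'_mem hA⟩
  have hne : (A.erase b).Nonempty := ⟨_, hmem⟩
  have hmin : (A.erase b).min' hne = A.min' hA :=
    le_antisymm (min'_le _ _ hmem) (min'_subset hne (erase_subset b A))
  rw [eraseMin_eq_erase hne, eraseMin_eq_erase hA, hmin, erase_right_comm]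

theorem hIdeal_rel_erase (k : Type) [Field k] (n : ℕ) {A : Finset (Fin n)} {i j : Fin n}
    (hi : i ∈ A) (hj : j ∈ A) :
    (hIdeal k n).ringCon (rGen k n A * rGen k n (A.erase i))
      (rGen k n A * rGen k n (A.erase j)) := by
  rw [TwoSidedIdeal.rel_iff, ← mul_sub]
  exact TwoSidedIdeal.subset_span ⟨A, i, hi, j, hj, rfl⟩

/-- Modulo the ideal, `r_A · S_{A∖b}^t` does not depend on `b ∈ A`. -/
theorem hIdeal_rel_mul_SMon_erase (k : Type) [Field k] (n t : ℕ) {A : Finset (Fin n)} {b : Fin n}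
    (hb : b ∈ A) :
    (hIdeal k n).ringCon (rGen k n A * SMon k n t (eraseMin A))
      (rGen k n A * SMon k n t (A.erase b)) := by
  induction t generalizing A b with
  | zero =>
    rw [eraseMin_eq_erase ⟨b, hb⟩]
    exact hIdeal_rel_erase k n (min'_mem _ _) hb
  | succ t ih =>
    have hA : A.Nonempty := ⟨b, hb⟩
    by_cases hbm : b = A.min' hA
    · rw [eraseMin_eq_erase hA, ← hbm]
      exact (hIdeal k n).ringCon.refl _
    · have hb' : b ∈ eraseMin A := by
        rw [eraseMin_eq_erase hA]
        exact mem_erase.2 ⟨hbm, hb⟩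
      have h₁ := (hIdeal k n).ringCon.mul ((hIdeal k n).ringCon.refl (rGen k n A)) (ih hb')
      have h₂ := (hIdeal k n).ringCon.mul (hIdeal_rel_erase k n (A.min'_mem hA) hb)
        ((hIdeal k n).ringCon.refl (SMon k n t ((eraseMin A).erase b)))
      rw [← eraseMin_eq_erase hA, mul_assoc, mul_assoc] at h₂
      rw [SMon, SMon, eraseMin_erase hA hbm]
      exact (hIdeal k n).ringCon.trans h₁ h₂

theorem hIdeal_rel_SMon_mul_sdiff (k : Type) [Field k] (n t : ℕ) {A B : Finset (Fin n)}
    (hBA : B ⊆ A) (hB : B.card = t + 1) :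
    (hIdeal k n).ringCon (SMon k n t A * rGen k n (A \ B)) (SMon k n (t + 1) A) := by
  induction t generalizing A B with
  | zero =>
    obtain ⟨b, rfl⟩ := card_eq_one.1 hB
    have hb : b ∈ A := hBA (mem_singleton_self b)
    rw [sdiff_singleton_eq_erase]
    exact (hIdeal k n).ringCon.symm (hIdeal_rel_mul_SMon_erase k n 0 hb)
  | succ t ih =>
    obtain ⟨b, hb⟩ : B.Nonempty := card_pos.1 (by omega)
    have hsdiff : A.erase b \ B.erase b = A \ B := by
      ext x
      simp only [mem_sdiff, mem_erase]
      grind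
    have h₁ := (hIdeal k n).ringCon.mul (hIdeal_rel_mul_SMon_erase k n t (hBA hb))
      ((hIdeal k n).ringCon.refl (rGen k n (A \ B)))
    have h₂ := (hIdeal k n).ringCon.mul ((hIdeal k n).ringCon.refl (rGen k n A))
      (ih (erase_subset_erase b hBA) (by rw [card_erase_of_mem hb, hB]; rfl))
    rw [hsdiff, ← mul_assoc] at h₂
    exact (hIdeal k n).ringCon.trans h₁ ((hIdeal k n).ringCon.trans h₂
      ((hIdeal k n).ringCon.symm (hIdeal_rel_mul_SMon_erase k n (t + 1) (hBA hb))))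

theorem gElt_mem_hIdeal (k : Type) [Field k] (n : ℕ) (hn : 2 ≤ n)
    (A : Finset (Fin n)) (hA : A.Nonempty) (t : ℕ) (B : Finset (Fin n))
    (hBA : B ⊆ A) (hBcard : B.card = t + 1) (hmin : A.min' hA ∉ B) :
    gElt k n t A B ∈ hIdeal k n := by
  exact (TwoSidedIdeal.rel_iff _ _ _).1 (hIdeal_rel_SMon_mul_sdiff k n t hBA hBcard)
end
end

section
/- For every field k and every integer n ≥ 2, the images in gn = F/I of the normal monomials form a k-vector-space basis of gn. -/
/-!
STATEMENT 4: For every field `k` and every integer `n ≥ 2`, the images in `gn = F/I` of the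
normal monomials form a `k`-vector-space basis of `gn`. A monomial is normal if it is of
the form `S_{A^1}^{j_1} ⋯ S_{A^m}^{j_m}` (`m ≥ 0`, empty product being `1`), where each
block is a genuine `S`-monomial (`A^i` nonempty, `0 ≤ j_i ≤ |A^i| − 1`) and, for every
`1 ≤ i < m`, either `A^{i+1} ⊄ A^i` or `|A^{i+1}| ≠ |A^i| − j_i − 1`.
-/

noncomputable section

open Finset

/-- The relation identifying each `h_{A;i,j}` (for `i, j ∈ A`) with `0`. -/
inductive GnRel (k : Type) [Field k] (n : ℕ) : FreeA k n → FreeA k n → Prop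
  | rel (A : Finset (Fin n)) (i j : Fin n) (hi : i ∈ A) (hj : j ∈ A) :
      GnRel k n (hRel k n A i j) 0

/-- The algebra `gn = F/I`. -/
abbrev Gn (k : Type) [Field k] (n : ℕ) := RingQuot (GnRel k n)

/-- The quotient map `F → gn`. -/
def GnMk (k : Type) [Field k] (n : ℕ) : FreeA k n →ₐ[k] Gn k n :=
  RingQuot.mkAlgHom k (GnRel k n)

/-- A word, encoded as the list of pairs `(A^i, j_i)`, is normal iff every block `(A, j)` is
a genuine `S`-monomial (`A` nonempty, `j + 1 ≤ |A|`) and consecutive blocks `(A, j)`,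
`(A', j')` satisfy `A' ⊄ A` or `|A'| ≠ |A| − j − 1`. -/
def IsNormalWord (n : ℕ) (l : List (Finset (Fin n) × ℕ)) : Prop :=
  (∀ p ∈ l, p.1.Nonempty ∧ p.2 + 1 ≤ p.1.card) ∧
    List.Chain' (fun p q : Finset (Fin n) × ℕ =>
      ¬ q.1 ⊆ p.1 ∨ q.1.card ≠ p.1.card - p.2 - 1) l

/-- The monomial `S_{A^1}^{j_1} ⋯ S_{A^m}^{j_m} ∈ F` encoded by a word. -/
def wordVal (k : Type) [Field k] (n : ℕ) (l : List (Finset (Fin n) × ℕ)) : FreeA k n :=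
  (l.map (fun p => SMon k n p.2 p.1)).prod

/-- Right multiplication by a generator, acting on words stored with their last block first. -/
def appendGen {n : ℕ} (B : Finset (Fin n)) :
    List (Finset (Fin n) × ℕ) → List (Finset (Fin n) × ℕ)
  | [] => [(B, 0)]
  | p :: s => if B ⊆ p.1 ∧ B.card + p.2 + 1 = p.1.card then (p.1, p.2 + 1) :: s
      else (B, 0) :: p :: s

lemma appendGen_cons_of_absorb {n : ℕ} {B C : Finset (Fin n)} {i : ℕ} (h : B ⊆ C)
    (hc : B.card + i + 1 = C.card) (s : List (Finset (Fin n) × ℕ)) :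
    appendGen B ((C, i) :: s) = (C, i + 1) :: s := by
  simp [appendGen, h, hc]

lemma appendGen_of_not_absorb {n : ℕ} {B : Finset (Fin n)} {s : List (Finset (Fin n) × ℕ)}
    (h : ∀ p ∈ s.head?, ¬ (B ⊆ p.1 ∧ B.card + p.2 + 1 = p.1.card)) :
    appendGen B s = (B, 0) :: s := by
  cases s with
  | nil => rfl
  | cons p s => exact if_neg (h p (by simp))

lemma appendGen_erase {n : ℕ} {A : Finset (Fin n)} {i j : Fin n} (hi : i ∈ A) (hj : j ∈ A)
    (hA : 2 ≤ A.card) (s : List (Finset (Fin n) × ℕ)) :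
    appendGen (A.erase i) (appendGen A s) = appendGen (A.erase j) (appendGen A s) := by
  obtain ⟨C, m, t, h, hs, hc⟩ : ∃ C m t, appendGen A s = (C, m) :: t ∧ A ⊆ C ∧
      A.card + m = C.card := by
    cases s with
    | nil => exact ⟨A, 0, [], rfl, Subset.rfl, rfl⟩
    | cons p s =>
      by_cases hp : A ⊆ p.1 ∧ A.card + p.2 + 1 = p.1.card
      · exact ⟨p.1, p.2 + 1, s, if_pos hp, hp.1, hp.2⟩
      · exact ⟨A, 0, p :: s, if_neg hp, Subset.rfl, rfl⟩
  have absorb (x : Fin n) (hx : x ∈ A) :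
      appendGen (A.erase x) ((C, m) :: t) = (C, m + 1) :: t :=
    appendGen_cons_of_absorb ((erase_subset x A).trans hs)
      (by rw [card_erase_of_mem hx]; omega) t
  rw [h, absorb i hi, absorb j hj]

lemma card_eraseMin {n : ℕ} {A : Finset (Fin n)} (h : A.Nonempty) :
    (eraseMin A).card + 1 = A.card := by
  rw [eraseMin, dif_pos h, card_erase_add_one (min'_mem A h)]

lemma eraseMin_subset {n : ℕ} (A : Finset (Fin n)) : eraseMin A ⊆ A := by
  unfold eraseMin
  split_ifs
  exacts [erase_subset _ _, empty_subset _]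

/-- The right action of the free algebra on the space spanned by all words. -/
def wordAction (k : Type) [Field k] (n : ℕ) :
    FreeA k n →ₐ[k] (Module.End k (List (Finset (Fin n) × ℕ) →₀ k))ᵐᵒᵖ :=
  FreeAlgebra.lift k fun B => MulOpposite.op (Finsupp.lmapDomain k k (appendGen B.1))

section
variable (k : Type) [Field k] {n : ℕ}

lemma wordAction_rGen {A : Finset (Fin n)} (hA : A.Nonempty) :
    wordAction k n (rGen k n A) = MulOpposite.op (Finsupp.lmapDomain k k (appendGen A)) := by
  simp [rGen, hA, wordAction]

lemma wordAction_hRel (A : Finset (Fin n)) (i j : Fin n) (hi : i ∈ A) (hj : j ∈ A) :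
    wordAction k n (hRel k n A i j) = 0 := by
  obtain rfl | hij := eq_or_ne i j
  · simp [hRel]
  have hA : 2 ≤ A.card := one_lt_card.2 ⟨i, hi, j, hj, hij⟩
  rw [hRel, mul_sub, map_sub, map_mul, map_mul, wordAction_rGen k ⟨i, hi⟩,
    wordAction_rGen k ⟨j, mem_erase.2 ⟨hij.symm, hj⟩⟩,
    wordAction_rGen k ⟨i, mem_erase.2 ⟨hij, hi⟩⟩, ← MulOpposite.op_mul, ← MulOpposite.op_mul,
    sub_eq_zero]
  refine congrArg MulOpposite.op (Finsupp.lhom_ext fun s c => ?_)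
  simp [Finsupp.mapDomain_single, appendGen_erase hi hj hA s]

/-- The action of `wordAction`, descended to the quotient algebra. -/
def gnAction (n : ℕ) : Gn k n →ₐ[k] (Module.End k (List (Finset (Fin n) × ℕ) →₀ k))ᵐᵒᵖ :=
  RingQuot.liftAlgHom k ⟨wordAction k n, by
    rintro _ _ ⟨A, i, j, hi, hj⟩
    rw [wordAction_hRel k A i j hi hj, map_zero]⟩

lemma gnAction_GnMk (x : FreeA k n) : gnAction k n (GnMk k n x) = wordAction k n x :=
  RingQuot.liftAlgHom_mkAlgHom_apply ..

lemma unop_wordAction_mul (x y : FreeA k n) (v : List (Finset (Fin n) × ℕ) →₀ k) :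
    (wordAction k n (x * y)).unop v = (wordAction k n y).unop ((wordAction k n x).unop v) := by
  rw [map_mul]
  rfl

lemma wordAction_rGen_single {A : Finset (Fin n)} (hA : A.Nonempty)
    (s : List (Finset (Fin n) × ℕ)) :
    (wordAction k n (rGen k n A)).unop (Finsupp.single s 1) =
      Finsupp.single (appendGen A s) 1 := by
  simp [wordAction_rGen k hA, Finsupp.mapDomain_single]

lemma wordAction_SMon_absorb (t : ℕ) (A C : Finset (Fin n)) (i : ℕ)
    (s : List (Finset (Fin n) × ℕ)) (ht : t + 1 ≤ A.card) (h : A ⊆ C)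
    (hc : A.card + i + 1 = C.card) :
    (wordAction k n (SMon k n t A)).unop (Finsupp.single ((C, i) :: s) 1) =
      Finsupp.single ((C, i + t + 1) :: s) 1 := by
  induction t generalizing A i with
  | zero =>
    rw [SMon, wordAction_rGen_single k (card_pos.1 (by omega)), appendGen_cons_of_absorb h hc]
  | succ t ih =>
    have hA : A.Nonempty := card_pos.1 (by omega)
    have := card_eraseMin hA
    rw [SMon, unop_wordAction_mul, wordAction_rGen_single k hA, appendGen_cons_of_absorb h hc,
      ih _ _ (by omega) ((eraseMin_subset A).trans h) (by omega),
      show i + 1 + t + 1 = i + (t + 1) + 1 by omega]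

lemma wordAction_SMon {t : ℕ} {A : Finset (Fin n)} {s : List (Finset (Fin n) × ℕ)}
    (ht : t + 1 ≤ A.card)
    (h : ∀ p ∈ s.head?, ¬ (A ⊆ p.1 ∧ A.card + p.2 + 1 = p.1.card)) :
    (wordAction k n (SMon k n t A)).unop (Finsupp.single s 1) =
      Finsupp.single ((A, t) :: s) 1 := by
  have hA : A.Nonempty := card_pos.1 (by omega)
  cases t with
  | zero => rw [SMon, wordAction_rGen_single k hA, appendGen_of_not_absorb h]
  | succ t =>
    have := card_eraseMin hA
    rw [SMon, unop_wordAction_mul, wordAction_rGen_single k hA, appendGen_of_not_absorb h,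
      wordAction_SMon_absorb k _ _ _ _ _ (by omega) (eraseMin_subset A) (by omega), zero_add]

lemma wordAction_wordVal (l s : List (Finset (Fin n) × ℕ)) (hl : IsNormalWord n l)
    (h : ∀ q ∈ l.head?, ∀ p ∈ s.head?, ¬ (q.1 ⊆ p.1 ∧ q.1.card + p.2 + 1 = p.1.card)) :
    (wordAction k n (wordVal k n l)).unop (Finsupp.single s 1) =
      Finsupp.single (l.reverse ++ s) 1 := by
  induction l generalizing s with
  | nil => simp [wordVal]
  | cons q l ih =>
    obtain ⟨hb, hc⟩ := hl
    have hc' := List.isChain_cons.1 hc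
    have hval : wordVal k n (q :: l) = SMon k n q.2 q.1 * wordVal k n l := by simp [wordVal]
    rw [hval, unop_wordAction_mul, wordAction_SMon k (hb q (by simp)).2 (h q (by simp)),
      ih _ ⟨fun p hp => hb p (by simp [hp]), hc'.2⟩ ?_]
    · simp
    · intro r hr p hp
      obtain rfl : q = p := by simpa using hp
      rintro ⟨h1, h2⟩
      rcases hc'.1 r hr with h3 | h3
      · exact h3 h1
      · omega

lemma GnMk_rGen_mul_erase {A : Finset (Fin n)} {i j : Fin n} (hi : i ∈ A) (hj : j ∈ A) :
    GnMk k n (rGen k n A) * GnMk k n (rGen k n (A.erase i)) =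
      GnMk k n (rGen k n A) * GnMk k n (rGen k n (A.erase j)) := by
  have h : GnMk k n (hRel k n A i j) = GnMk k n 0 :=
    RingQuot.mkAlgHom_rel k (GnRel.rel A i j hi hj)
  rwa [hRel, mul_sub, map_sub, map_zero, sub_eq_zero, map_mul, map_mul] at h

lemma GnMk_rGen_mul_SMon_erase (t : ℕ) {A : Finset (Fin n)} {x : Fin n} (hx : x ∈ A) :
    GnMk k n (rGen k n A) * GnMk k n (SMon k n t (A.erase x)) =
      GnMk k n (SMon k n (t + 1) A) := by
  induction t generalizing A with
  | zero =>
    have hA : A.Nonempty := ⟨x, hx⟩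
    rw [SMon, SMon, SMon, map_mul, eraseMin, dif_pos hA,
      GnMk_rGen_mul_erase k hx (min'_mem A hA)]
  | succ t ih =>
    have hA : A.Nonempty := ⟨x, hx⟩
    have hm := min'_mem A hA
    have he : eraseMin A = A.erase (A.min' hA) := dif_pos hA
    rw [SMon.eq_def k n (t + 1 + 1), map_mul, he]
    by_cases hxm : x = A.min' hA
    · rw [← hxm]
    have hmx : A.min' hA ∈ A.erase x := mem_erase.2 ⟨Ne.symm hxm, hm⟩
    have hne : (A.erase x).Nonempty := ⟨_, hmx⟩
    have hmin : (A.erase x).min' hne = A.min' hA :=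
      le_antisymm (min'_le _ _ hmx) (min'_subset hne (erase_subset x A))
    rw [SMon, map_mul, ← mul_assoc, GnMk_rGen_mul_erase k hx hm, eraseMin, dif_pos hne, hmin,
      erase_right_comm, mul_assoc, ih (mem_erase.2 ⟨hxm, hx⟩)]

lemma GnMk_SMon_mul_rGen (t : ℕ) {A B : Finset (Fin n)} (h : B ⊆ A)
    (hc : B.card + t + 1 = A.card) :
    GnMk k n (SMon k n t A) * GnMk k n (rGen k n B) = GnMk k n (SMon k n (t + 1) A) := by
  obtain ⟨x, hx, hxB⟩ := exists_mem_notMem_of_card_lt_card (show B.card < A.card by omega)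
  have hBx : B ⊆ A.erase x := subset_erase.2 ⟨h, hxB⟩
  have hcx := card_erase_add_one hx
  induction t generalizing A x with
  | zero =>
    obtain rfl : B = A.erase x := eq_of_subset_of_card_le hBx (by omega)
    exact GnMk_rGen_mul_SMon_erase k 0 hx
  | succ t ih =>
    obtain ⟨y, hy, hyB⟩ :=
      exists_mem_notMem_of_card_lt_card (show B.card < (A.erase x).card by omega)
    rw [← GnMk_rGen_mul_SMon_erase k t hx, mul_assoc,
      ih hBx (by omega) y hy hyB (subset_erase.2 ⟨hBx, hyB⟩) (card_erase_add_one hy),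
      GnMk_rGen_mul_SMon_erase k _ hx]

lemma wordVal_reverse_cons (p : Finset (Fin n) × ℕ) (s : List (Finset (Fin n) × ℕ)) :
    wordVal k n (p :: s).reverse = wordVal k n s.reverse * SMon k n p.2 p.1 := by
  simp [wordVal]

lemma GnMk_wordVal_mul_rGen (B : Finset (Fin n)) (s : List (Finset (Fin n) × ℕ)) :
    GnMk k n (wordVal k n s.reverse) * GnMk k n (rGen k n B) =
      GnMk k n (wordVal k n (appendGen B s).reverse) := by
  cases s with
  | nil => simp [wordVal, appendGen, SMon]
  | cons p s =>
    by_cases hp : B ⊆ p.1 ∧ B.card + p.2 + 1 = p.1.card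
    · rw [appendGen, if_pos hp, wordVal_reverse_cons, wordVal_reverse_cons, map_mul, map_mul,
        mul_assoc, GnMk_SMon_mul_rGen k _ hp.1 hp.2]
    · rw [appendGen, if_neg hp, wordVal_reverse_cons k (B, 0), map_mul, SMon]

end

lemma IsNormalWord.appendGen {n : ℕ} {B : Finset (Fin n)} (hB : B.Nonempty)
    {s : List (Finset (Fin n) × ℕ)} (hs : IsNormalWord n s.reverse) :
    IsNormalWord n (appendGen B s).reverse := by
  obtain ⟨hb, hc⟩ := hs
  have hBc := hB.card_pos
  replace hc := List.isChain_reverse.1 hc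
  simp only [List.mem_reverse] at hb
  refine ⟨?_, List.isChain_reverse.2 ?_⟩
  · simp only [List.mem_reverse]
    cases s with
    | nil => simp [_root_.appendGen, hB]
    | cons p s =>
      intro q hq
      by_cases hp : B ⊆ p.1 ∧ B.card + p.2 + 1 = p.1.card
      · rw [_root_.appendGen, if_pos hp, List.mem_cons] at hq
        rcases hq with rfl | hq
        · exact ⟨(hb p (by simp)).1, by dsimp only; omega⟩
        · exact hb q (by simp [hq])
      · rw [_root_.appendGen, if_neg hp, List.mem_cons] at hq
        rcases hq with rfl | hq
        · exact ⟨hB, by dsimp only; omega⟩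
        · exact hb q hq
  · cases s with
    | nil => simp [_root_.appendGen]
    | cons p s =>
      by_cases hp : B ⊆ p.1 ∧ B.card + p.2 + 1 = p.1.card
      · rw [_root_.appendGen, if_pos hp]
        exact List.isChain_cons.2 ⟨(List.isChain_cons.1 hc).1, (List.isChain_cons.1 hc).2⟩
      · rw [_root_.appendGen, if_neg hp]
        refine List.isChain_cons_cons.2 ⟨?_, hc⟩
        change ¬ B ⊆ p.1 ∨ B.card ≠ p.1.card - p.2 - 1
        by_contra! hcon
        exact hp ⟨hcon.1, by omega⟩

theorem normal_monomials_basis_Gn (k : Type) [Field k] (n : ℕ) (hn : 2 ≤ n) :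
    LinearIndependent k
      (fun l : {l : List (Finset (Fin n) × ℕ) // IsNormalWord n l} =>
        GnMk k n (wordVal k n l.1)) ∧
    Submodule.span k
      (Set.range (fun l : {l : List (Finset (Fin n) × ℕ) // IsNormalWord n l} =>
        GnMk k n (wordVal k n l.1))) = ⊤ := by
  constructor
  · let f : Gn k n →ₗ[k] (List (Finset (Fin n) × ℕ) →₀ k) :=
      LinearMap.applyₗ (Finsupp.single [] 1) ∘ₗ
        (MulOpposite.opLinearEquiv k).symm.toLinearMap ∘ₗ (gnAction k n).toLinearMap
    refine LinearIndependent.of_comp f ?_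
    have hsub (x : FreeA k n) :
        f (GnMk k n x) = (wordAction k n x).unop (Finsupp.single [] 1) :=
      congrArg (fun g => g.unop (Finsupp.single [] 1)) (gnAction_GnMk k x)
    have hf : f ∘ (fun l : {l : List (Finset (Fin n) × ℕ) // IsNormalWord n l} =>
        GnMk k n (wordVal k n l.1)) = fun l => Finsupp.single l.1.reverse 1 := by
      funext l
      rw [Function.comp_apply, hsub, wordAction_wordVal k l.1 [] l.2 (by simp), List.append_nil]
    rw [hf]
    have hsingle : LinearIndependent k (fun s : List (Finset (Fin n) × ℕ) =>
        (Finsupp.single s 1 : List (Finset (Fin n) × ℕ) →₀ k)) :=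
      Finsupp.linearIndependent_single_one k _
    exact hsingle.comp (fun l : {l // IsNormalWord n l} => l.1.reverse)
      (List.reverse_injective.comp Subtype.val_injective)
  · set W := Submodule.span k
      (Set.range (fun l : {l : List (Finset (Fin n) × ℕ) // IsNormalWord n l} =>
        GnMk k n (wordVal k n l.1))) with hW
    have hmul (x : FreeA k n) : ∀ w ∈ W, w * GnMk k n x ∈ W := by
      induction x using FreeAlgebra.induction with
      | grade0 r =>
        intro w hw
        rw [AlgHom.commutes, ← Algebra.commutes, ← Algebra.smul_def]
        exact W.smul_mem r hw
      | grade1 B =>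
        intro w hw
        rw [hW] at hw
        induction hw using Submodule.span_induction with
        | mem w hw =>
          obtain ⟨⟨l, hl⟩, rfl⟩ := hw
          have hB : FreeAlgebra.ι k B = rGen k n B.1 := by simp [rGen, B.2]
          have h := GnMk_wordVal_mul_rGen k B.1 l.reverse
          rw [List.reverse_reverse] at h
          dsimp only
          rw [hB, h]
          exact Submodule.subset_span
            ⟨⟨_, IsNormalWord.appendGen B.2 (by rwa [List.reverse_reverse])⟩, rfl⟩
        | zero => simp
        | add v w _ _ hv hw => rw [add_mul]; exact W.add_mem hv hw
        | smul c v _ hv => rw [smul_mul_assoc]; exact W.smul_mem c hv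
      | mul x y hx hy =>
        intro w hw
        rw [map_mul, ← mul_assoc]
        exact hy _ (hx _ hw)
      | add x y hx hy =>
        intro w hw
        rw [map_add, mul_add]
        exact W.add_mem (hx _ hw) (hy _ hw)
    have hone : (1 : Gn k n) ∈ W :=
      Submodule.subset_span ⟨⟨[], by simp, List.isChain_nil⟩, by simp [wordVal]⟩
    refine eq_top_iff.2 fun y _ => ?_
    obtain ⟨x, rfl⟩ := RingQuot.mkAlgHom_surjective k (GnRel k n) y
    simpa [GnMk] using hmul x 1 hone
end
end
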